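/- arXiv:math/9803117 — 3 statements merged into one kernel-verified Lean document; each statement's English description precedes it below -/
import Mathlib

section
/- For every q ∈ ℂ and every z in the open unit ball B(1) of l¹, the family indexed by multiindices k with terms (‖k‖^{‖k‖}/k^k)·|q|^{#k}·|z^k| is summable, so Δ(q,z) is well defined and finite; the function Δ is continuous on ℂ × B(1); and the convergence is uniform on compact subsets of ℂ × B(1), i.e., for every compact K ⊆ ℂ × B(1) and every ε > 0 there is а finite set F of multiindices such that ∑_{k ∉ F} (‖k‖^{‖k‖}/k^k)|q|^{#k}|z^k| < ε for all (q,z) ∈ K. -/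
open Set
open scoped ENNReal NNReal

noncomputable section

/-- `l¹`: the space of absolutely summable sequences of complex numbers. -/
abbrev L1 : Type := lp (fun _ : ℕ => ℂ) 1

/-- `ℂ^N` equipped with the `l¹` norm. -/
abbrev EN (N : ℕ) : Type := PiLp 1 (fun _ : Fin N => ℂ)

/-- The `(0,1)`-part of the real Fréchet derivative of `u` at `z`, applied to `ξ`:
`∂̄u(z)(ξ) = (Du(z)(ξ) + i·Du(z)(iξ))/2`. -/
noncomputable def dbar {V : Type*} [NormedAddCommGroup V] [NormedSpace ℂ V]
    (u : V → ℂ) (z ξ : V) : ℂ :=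
  (fderiv ℝ u z ξ + Complex.I * fderiv ℝ u z (Complex.I • ξ)) / 2

/-- `f` is a `(0,1)`-form of class `C^m` on `Ω`: each `f z` is (continuous) conjugate-linear
and `(z,ξ) ↦ f z ξ` is `m` times continuously differentiable in the real sense on `Ω × V`. -/
def IsForm01 {V : Type*} [NormedAddCommGroup V] [NormedSpace ℂ V]
    (m : ℕ) (Ω : Set V) (f : V → V → ℂ) : Prop :=
  (∀ z ∈ Ω, ∀ ξ η : V, f z (ξ + η) = f z ξ + f z η) ∧
  (∀ z ∈ Ω, ∀ (a : ℂ) (ξ : V), f z (a • ξ) = (starRingEnd ℂ) a * f z ξ) ∧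
  ContDiffOn ℝ m (fun p : V × V => f p.1 p.2) (Ω ×ˢ (univ : Set V))

/-- A `(0,1)`-form `f` is `∂̄`-closed on `Ω`. -/
def DbarClosed {V : Type*} [NormedAddCommGroup V] [NormedSpace ℂ V]
    (Ω : Set V) (f : V → V → ℂ) : Prop :=
  ∀ z ∈ Ω, ∀ ξ η : V, dbar (fun w => f w ξ) z η = dbar (fun w => f w η) z ξ

/-- The set of values `‖f z ξ‖`, `z ∈ A`, `‖ξ‖ ≤ 1`; its sup is `|f|_{0,A}`. -/
def formSet0 {V : Type*} [NormedAddCommGroup V]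
    (f : V → V → ℂ) (A : Set V) : Set ℝ :=
  {x | ∃ z ∈ A, ∃ ξ : V, ‖ξ‖ ≤ 1 ∧ x = ‖f z ξ‖}

/-- The set of difference quotients `‖f z ξ - f w ξ‖/‖z-w‖`; its sup is `|f|_{1,A}`. -/
def formSet1 {V : Type*} [NormedAddCommGroup V]
    (f : V → V → ℂ) (A : Set V) : Set ℝ :=
  {x | ∃ z ∈ A, ∃ w ∈ A, z ≠ w ∧ ∃ ξ : V, ‖ξ‖ ≤ 1 ∧ x = ‖f z ξ - f w ξ‖ / ‖z - w‖}

/-- `|f|_{0,A}`. -/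
noncomputable def formNorm0 {V : Type*} [NormedAddCommGroup V]
    (f : V → V → ℂ) (A : Set V) : ℝ := sSup (formSet0 f A)

/-- `|f|_{1,A}`. -/
noncomputable def formNorm1 {V : Type*} [NormedAddCommGroup V]
    (f : V → V → ℂ) (A : Set V) : ℝ := sSup (formSet1 f A)

/-- `f` is Lipschitz continuous on `A`: `|f|_{0,A} < ∞` and `|f|_{1,A} < ∞`. -/
def LipschitzForm {V : Type*} [NormedAddCommGroup V]
    (f : V → V → ℂ) (A : Set V) : Prop :=
  BddAbove (formSet0 f A) ∧ BddAbove (formSet1 f A)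

/-- `‖k‖ = ∑_ν k_ν` for a multiindex `k`. -/
def knormN (k : ℕ →₀ ℕ) : ℕ := k.sum fun _ m => m

/-- `k^k = ∏_ν k_ν^{k_ν}` (with `0^0 = 1`). -/
noncomputable def kk (k : ℕ →₀ ℕ) : ℝ := ∏ ν ∈ k.support, (k ν : ℝ) ^ k ν

/-- `‖k‖^{‖k‖}` (with `0^0 = 1`). -/
noncomputable def nn (k : ℕ →₀ ℕ) : ℝ := ((knormN k : ℝ)) ^ knormN k

/-- The monomial `z^k = ∏_ν z_ν^{k_ν}` (with `0^0 = 1`). -/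
noncomputable def monom (k : ℕ →₀ ℕ) (z : ℕ → ℂ) : ℂ := ∏ ν ∈ k.support, z ν ^ k ν

/-- The term of the series defining `Δ(q,z)` corresponding to the multiindex `k`:
`(‖k‖^{‖k‖}/k^k)·|q|^{#k}·|z^k|`. -/
noncomputable def DeltaTerm (q : ℂ) (z : ℕ → ℂ) (k : ℕ →₀ ℕ) : ℝ :=
  (nn k / kk k) * ‖q‖ ^ k.support.card * ∏ ν ∈ k.support, ‖z ν‖ ^ k ν

/-- `Δ(q,z) = ∑_k (‖k‖^{‖k‖}/k^k)·|q|^{#k}·|z^k|`. -/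
noncomputable def Delta (q : ℂ) (z : ℕ → ℂ) : ℝ := ∑' k, DeltaTerm q z k

open Filter Topology in
/-- Multinomial series. -/
theorem aux_multinomial (w : ℕ → ℝ) (hw : ∀ i, 0 ≤ w i) (W : ℝ) (hW : HasSum w W) (hW1 : W < 1) :
    HasSum (fun k : ℕ →₀ ℕ => (k.multinomial : ℝ) * ∏ i ∈ k.support, w i ^ k i) (1 - W)⁻¹ := by
  classical
  have hW0 : 0 ≤ W := hW.nonneg hw
  set g : (ℕ →₀ ℕ) → ℝ := fun k => (k.multinomial : ℝ) * ∏ i ∈ k.support, w i ^ k i with hg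
  have g0 : ∀ k, 0 ≤ g k := fun k =>
    mul_nonneg (Nat.cast_nonneg _) (Finset.prod_nonneg fun i _ => pow_nonneg (hw i) _)
  have key : ∀ (s : Finset ℕ) (n : ℕ), ∑ k ∈ s.finsuppAntidiag n, g k = (∑ i ∈ s, w i) ^ n := by
    intro s n
    rw [Finset.sum_pow_eq_sum_piAntidiag]
    refine Finset.sum_bij' (fun k _ => (k : ℕ → ℕ))
      (fun f hf => Finsupp.onFinset s f (fun i hi => (Finset.mem_piAntidiag.1 hf).2 i hi))
      ?_ ?_ ?_ ?_ ?_
    · intro k hk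
      rw [Finset.mem_finsuppAntidiag] at hk
      rw [Finset.mem_piAntidiag]
      exact ⟨hk.1, fun i hi => hk.2 (Finsupp.mem_support_iff.2 hi)⟩
    · intro f hf
      rw [Finset.mem_finsuppAntidiag]
      exact ⟨(Finset.mem_piAntidiag.1 hf).1, Finsupp.support_onFinset_subset⟩
    · intro k hk; ext i; rfl
    · intro f hf; rfl
    · intro k hk
      rw [Finset.mem_finsuppAntidiag] at hk
      simp only [hg]
      rw [Finsupp.multinomial_eq_of_support_subset hk.2, Finset.prod_subset hk.2]
      intro i _ hi
      rw [Finsupp.notMem_support_iff.1 hi, pow_zero]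
  have key2 : ∀ (s : Finset ℕ) (m : ℕ),
      ∑ k ∈ (Finset.range m).biUnion (fun n => s.finsuppAntidiag n), g k
        = ∑ n ∈ Finset.range m, (∑ i ∈ s, w i) ^ n := by
    intro s m
    rw [Finset.sum_biUnion]
    · exact Finset.sum_congr rfl fun n _ => key s n
    · intro a _ b _ hab
      rw [Function.onFun, Finset.disjoint_left]
      intro k hka hkb
      rw [Finset.mem_finsuppAntidiag] at hka hkb
      exact hab (hka.1.symm.trans hkb.1)
  apply hasSum_of_isLUB_of_nonneg _ g0
  constructor
  · rintro _ ⟨F, rfl⟩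
    set s := F.biUnion (fun k => k.support) with hs
    set m := F.sup (fun k => s.sum k) + 1 with hm
    calc ∑ k ∈ F, g k ≤ ∑ k ∈ (Finset.range m).biUnion (fun n => s.finsuppAntidiag n), g k := by
          apply Finset.sum_le_sum_of_subset_of_nonneg
          · intro k hk
            rw [Finset.mem_biUnion]
            refine ⟨s.sum k, ?_, ?_⟩
            · rw [Finset.mem_range, hm, Nat.lt_succ_iff]
              exact Finset.le_sup (f := fun k : ℕ →₀ ℕ => s.sum k) hk
            · rw [Finset.mem_finsuppAntidiag]
              exact ⟨rfl, Finset.subset_biUnion_of_mem (fun k : ℕ →₀ ℕ => k.support) hk⟩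
          · intro k _ _; exact g0 k
      _ = ∑ n ∈ Finset.range m, (∑ i ∈ s, w i) ^ n := key2 s m
      _ ≤ ∑ n ∈ Finset.range m, W ^ n := by
          apply Finset.sum_le_sum
          intro n _
          exact pow_le_pow_left₀ (Finset.sum_nonneg fun i _ => hw i)
            (sum_le_hasSum s (fun i _ => hw i) hW) n
      _ ≤ (1 - W)⁻¹ := sum_le_hasSum _ (fun i _ => pow_nonneg hW0 i)
            (hasSum_geometric_of_lt_one hW0 hW1)
  · intro u hu
    have h1 : ∀ (s : Finset ℕ) (m : ℕ), ∑ n ∈ Finset.range m, (∑ i ∈ s, w i) ^ n ≤ u := by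
      intro s m
      rw [← key2]
      exact hu ⟨_, rfl⟩
    have h2 : ∀ m : ℕ, ∑ n ∈ Finset.range m, W ^ n ≤ u := by
      intro m
      have hW' : Tendsto (fun s : Finset ℕ => ∑ i ∈ s, w i) atTop (𝓝 W) := hW
      have : Tendsto (fun s : Finset ℕ => ∑ n ∈ Finset.range m, (∑ i ∈ s, w i) ^ n) atTop
          (𝓝 (∑ n ∈ Finset.range m, W ^ n)) := tendsto_finsetSum _ fun n _ => hW'.pow n
      exact le_of_tendsto' this fun s => h1 s m
    exact le_of_tendsto' (hasSum_geometric_of_lt_one hW0 hW1).tendsto_sum_nat h2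

/-- A weak Stirling bound. -/
theorem aux_stirling (k : ℕ) (hk : 1 ≤ k) :
    (k.factorial : ℝ) * Real.exp k ≤ Real.exp 1 * k * (k : ℝ) ^ k := by
  induction k, hk using Nat.le_induction with
  | base => simp
  | succ k hk ih =>
    have hk0 : (0 : ℝ) < k := by exact_mod_cast hk
    have h1 : Real.exp 1 * (k : ℝ) ^ (k + 1) ≤ ((k : ℝ) + 1) ^ (k + 1) := by
      have h2 : Real.exp (1 / ((k : ℝ) + 1)) ≤ (k + 1) / k := by
        have h3 := Real.one_sub_inv_le_log_of_pos (x := ((k : ℝ) + 1) / k) (by positivity)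
        rw [← Real.le_log_iff_exp_le (by positivity)]
        refine le_trans (le_of_eq ?_) h3
        field_simp
        ring
      have h4 := pow_le_pow_left₀ (Real.exp_pos _).le h2 (k + 1)
      rw [← Real.exp_nat_mul] at h4
      have h5 : ((k + 1 : ℕ) : ℝ) * (1 / ((k : ℝ) + 1)) = 1 := by
        push_cast; field_simp
      rw [h5, div_pow, le_div_iff₀ (by positivity)] at h4
      exact h4
    rw [Nat.factorial_succ]
    push_cast
    rw [Real.exp_add]
    calc ((k : ℝ) + 1) * k.factorial * (Real.exp k * Real.exp 1)
        = (k + 1) * Real.exp 1 * (k.factorial * Real.exp k) := by ring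
      _ ≤ (k + 1) * Real.exp 1 * (Real.exp 1 * k * (k : ℝ) ^ k) := by gcongr
      _ = (k + 1) * Real.exp 1 * (Real.exp 1 * (k : ℝ) ^ (k + 1)) := by ring
      _ ≤ (k + 1) * Real.exp 1 * ((k : ℝ) + 1) ^ (k + 1) := by gcongr
      _ = _ := by ring

theorem aux_ratio (k : ℕ →₀ ℕ) :
    nn k / kk k ≤ (k.multinomial : ℝ) * ∏ i ∈ k.support, (Real.exp 1 * k i) := by
  have hpos : ∀ i ∈ k.support, 1 ≤ k i := fun i hi =>
    Nat.one_le_iff_ne_zero.2 (Finsupp.mem_support_iff.1 hi)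
  have hkk : 0 < kk k := Finset.prod_pos fun i hi =>
    pow_pos (by exact_mod_cast hpos i hi) _
  rw [div_le_iff₀ hkk]
  have hn : knormN k = ∑ i ∈ k.support, k i := rfl
  have h1 : nn k ≤ ((knormN k).factorial : ℝ) * Real.exp (knormN k) := by
    have := Real.pow_div_factorial_le_exp (x := (knormN k : ℝ)) (Nat.cast_nonneg _) (knormN k)
    rw [div_le_iff₀ (by positivity)] at this
    rw [nn]; linarith
  have h2 : ((knormN k).factorial : ℝ) = (∏ i ∈ k.support, ((k i).factorial : ℝ)) * k.multinomial := by
    rw [hn, ← Nat.multinomial_spec, Finsupp.multinomial_eq]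
    push_cast; rfl
  have h3 : Real.exp (knormN k) = ∏ i ∈ k.support, Real.exp (k i) := by
    rw [hn, ← Real.exp_sum]; push_cast; rfl
  calc nn k ≤ _ := h1
    _ = k.multinomial * ∏ i ∈ k.support, (((k i).factorial : ℝ) * Real.exp (k i)) := by
        rw [h2, h3, Finset.prod_mul_distrib]; ring
    _ ≤ k.multinomial * ∏ i ∈ k.support, (Real.exp 1 * k i * (k i : ℝ) ^ k i) := by
        refine mul_le_mul_of_nonneg_left ?_ (Nat.cast_nonneg _)
        exact Finset.prod_le_prod (fun i _ => by positivity)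
          fun i hi => aux_stirling _ (hpos i hi)
    _ = _ := by rw [Finset.prod_mul_distrib (g := fun i => (k i : ℝ) ^ k i), kk]; ring

theorem aux_nonneg (q : ℂ) (z : ℕ → ℂ) (k : ℕ →₀ ℕ) : 0 ≤ DeltaTerm q z k := by
  unfold DeltaTerm nn kk
  positivity

theorem aux_bound (δ Q M : ℝ) (hδ : 0 < δ) (hM : 1 ≤ M) (hMQ : Real.exp 1 * Q / δ ≤ M)
    (N : ℕ) (q : ℂ) (hq : ‖q‖ ≤ Q) (z : ℕ → ℂ) (k : ℕ →₀ ℕ) :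
    DeltaTerm q z k ≤ M ^ N * ((k.multinomial : ℝ) * ∏ i ∈ k.support,
      ((if i < N then 1 + δ else M * (1 + δ)) * ‖z i‖) ^ k i) := by
  have hM0 : 0 ≤ M := by linarith
  have hpos : ∀ i ∈ k.support, 1 ≤ k i := fun i hi =>
    Nat.one_le_iff_ne_zero.2 (Finsupp.mem_support_iff.1 hi)
  have hQ : 0 ≤ Q := (norm_nonneg q).trans hq
  have h1 : ∀ i ∈ k.support, Real.exp 1 * k i * ‖q‖ ≤
      (if i < N then M else 1) * (if i < N then 1 + δ else M * (1 + δ)) ^ k i := by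
    intro i hi
    have hb := one_add_mul_le_pow (a := δ) (by linarith) (k i)
    have hki : (k i : ℝ) ≤ (1 + δ) ^ k i / δ := by
      rw [le_div_iff₀ hδ]; linarith
    have h2 : Real.exp 1 * k i * ‖q‖ ≤ M * (1 + δ) ^ k i := by
      calc Real.exp 1 * k i * ‖q‖ ≤ Real.exp 1 * ((1 + δ) ^ k i / δ) * Q := by gcongr
        _ = (Real.exp 1 * Q / δ) * (1 + δ) ^ k i := by ring
        _ ≤ _ := by gcongr
    split_ifs with h
    · exact h2
    · rw [one_mul, mul_pow]
      refine h2.trans ?_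
      gcongr
      exact le_self_pow₀ hM (by have := hpos i hi; omega)
  have h3 : ∏ i ∈ k.support, (if i < N then M else 1) ≤ M ^ N := by
    rw [Finset.prod_ite, Finset.prod_const, Finset.prod_const_one, mul_one]
    apply pow_le_pow_right₀ hM
    calc _ ≤ (Finset.range N).card := Finset.card_le_card (by
            intro i hi; simp at hi ⊢; exact hi.2)
      _ = N := Finset.card_range N
  have hc : ∀ i : ℕ, (0 : ℝ) ≤ if i < N then 1 + δ else M * (1 + δ) := by
    intro i; split_ifs <;> positivity
  calc DeltaTerm q z k
      ≤ ((k.multinomial : ℝ) * ∏ i ∈ k.support, (Real.exp 1 * k i)) * ‖q‖ ^ k.support.card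
          * ∏ ν ∈ k.support, ‖z ν‖ ^ k ν := by
        unfold DeltaTerm
        gcongr
        exact aux_ratio k
    _ = k.multinomial * (∏ i ∈ k.support, (Real.exp 1 * k i * ‖q‖))
          * ∏ ν ∈ k.support, ‖z ν‖ ^ k ν := by
        rw [Finset.prod_mul_distrib (g := fun _ => ‖q‖), Finset.prod_const]; ring
    _ ≤ k.multinomial * (∏ i ∈ k.support,
          (if i < N then M else 1) * (if i < N then 1 + δ else M * (1 + δ)) ^ k i)
          * ∏ ν ∈ k.support, ‖z ν‖ ^ k ν := by
        refine mul_le_mul_of_nonneg_right (mul_le_mul_of_nonneg_left ?_ (Nat.cast_nonneg _))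
          (by positivity)
        exact Finset.prod_le_prod (fun i _ => by positivity) h1
    _ = (∏ i ∈ k.support, (if i < N then M else 1)) * (k.multinomial * ∏ i ∈ k.support,
          ((if i < N then 1 + δ else M * (1 + δ)) * ‖z i‖) ^ k i) := by
        simp only [mul_pow, Finset.prod_mul_distrib]; ring
    _ ≤ _ := by
        refine mul_le_mul_of_nonneg_right h3 (mul_nonneg (Nat.cast_nonneg _) ?_)
        exact Finset.prod_nonneg fun i _ => pow_nonneg (mul_nonneg (hc i) (norm_nonneg _)) _

theorem aux_l1 (z : L1) : HasSum (fun i => ‖z i‖) ‖z‖ := by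
  have := lp.hasSum_norm (p := 1) (by simp) z
  simpa using this

theorem aux_W (N : ℕ) (a b : ℝ) (z : L1) :
    HasSum (fun i => (if i < N then a else b) * ‖z i‖)
      (b * ‖z‖ - ∑ i ∈ Finset.range N, (b - a) * ‖z i‖) := by
  have h1 := (aux_l1 z).mul_left b
  have h2 : HasSum (fun i => if i < N then (b - a) * ‖z i‖ else 0)
      (∑ i ∈ Finset.range N, (b - a) * ‖z i‖) := by
    have := hasSum_sum_of_ne_finset_zero (L := SummationFilter.unconditional ℕ) (s := Finset.range N)
      (f := fun i => if i < N then (b - a) * ‖z i‖ else 0) (by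
        intro i hi; simp at hi; simp; intro h; omega)
    convert this using 1
    apply Finset.sum_congr rfl
    intro i hi
    rw [if_pos (Finset.mem_range.1 hi)]
  have h3 : (fun i => (if i < N then a else b) * ‖z i‖)
      = fun i => b * ‖z i‖ - if i < N then (b - a) * ‖z i‖ else 0 := by
    funext i
    split_ifs <;> ring
  rw [h3]
  exact h1.sub h2

theorem aux_coord (i : ℕ) : Continuous (fun p : ℂ × L1 => ‖p.2 i‖) := by
  have h : Continuous (fun z : L1 => z i) := by
    have : LipschitzWith 1 (fun z : L1 => z i) := by
      apply LipschitzWith.of_dist_le_mul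
      intro x y
      rw [dist_eq_norm, dist_eq_norm]
      simpa using lp.norm_apply_le_norm (p := 1) (by simp) (x - y) i
    exact this.continuous
  exact (h.comp continuous_snd).norm

open Filter Topology in
theorem aux_tail {X ι : Type*} [TopologicalSpace X] (p0 : X) (a b : X → ι → ℝ) (B : X → ℝ)
    (ha : ∀ p k, 0 ≤ a p k) (hab : ∀ᶠ p in 𝓝 p0, ∀ k, a p k ≤ b p k)
    (hb : ∀ k, ContinuousAt (fun p => b p k) p0) (hB : ∀ᶠ p in 𝓝 p0, HasSum (b p) (B p))
    (hBc : ContinuousAt B p0) (ε : ℝ) (hε : 0 < ε) :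
    ∃ F : Finset ι, ∀ᶠ p in 𝓝 p0, ∀ G, F ⊆ G → ∑' k : {k // k ∉ G}, a p k.1 < ε := by
  classical
  have h0 : Tendsto (fun F : Finset ι => ∑ k ∈ F, b p0 k) atTop (𝓝 (B p0)) := hB.self_of_nhds
  obtain ⟨F, hF⟩ := (h0.eventually (lt_mem_nhds (sub_lt_self (B p0) hε))).exists
  refine ⟨F, ?_⟩
  have hc : ContinuousAt (fun p => B p - ∑ k ∈ F, b p k) p0 :=
    hBc.sub (tendsto_finsetSum _ fun k _ => hb k)
  have hlt : ∀ᶠ p in 𝓝 p0, B p - ∑ k ∈ F, b p k < ε :=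
    hc.eventually (gt_mem_nhds (by linarith))
  filter_upwards [hlt, hab, hB] with p h1 h2 h3 G hFG
  have hbs := h3.summable
  have has : Summable (a p) := Summable.of_nonneg_of_le (ha p) h2 hbs
  have h4 := hbs.sum_add_tsum_subtype_compl G
  rw [h3.tsum_eq] at h4
  have h5 : ∑' k : {k // k ∉ G}, a p k.1 ≤ ∑' k : {k // k ∉ G}, b p k.1 :=
    Summable.tsum_le_tsum (fun k => h2 k.1) (has.subtype _) (hbs.subtype _)
  have h6 : ∑ k ∈ F, b p k ≤ ∑ k ∈ G, b p k :=
    Finset.sum_le_sum_of_subset_of_nonneg hFG fun k _ _ => (ha p k).trans (h2 k)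
  linarith

open Filter Topology in
theorem aux_main (p0 : ℂ × L1) (hp0 : ‖p0.2‖ < 1) :
    Summable (DeltaTerm p0.1 (fun ν => p0.2 ν)) ∧ 
    (∀ᶠ p in 𝓝 p0, Summable (DeltaTerm p.1 (fun ν => p.2 ν))) ∧
    ∀ ε : ℝ, 0 < ε → ∃ F : Finset (ℕ →₀ ℕ), ∀ᶠ p in 𝓝 p0, ∀ G, F ⊆ G →
      ∑' k : {k : ℕ →₀ ℕ // k ∉ G}, DeltaTerm p.1 (fun ν => p.2 ν) k.1 < ε := by
  obtain ⟨δ, hδ, hδ1⟩ : ∃ δ : ℝ, 0 < δ ∧ (1 + δ) * ‖p0.2‖ < 1 := by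
    refine ⟨(1 - ‖p0.2‖) / 2, by linarith, ?_⟩
    nlinarith [norm_nonneg p0.2]
  set Q := ‖p0.1‖ + 1
  set M := max 1 (Real.exp 1 * Q / δ)
  have hM : 1 ≤ M := le_max_left _ _
  have hMQ : Real.exp 1 * Q / δ ≤ M := le_max_right _ _
  set W : ℕ → ℂ × L1 → ℝ := fun N p => M * (1 + δ) * ‖p.2‖
    - ∑ i ∈ Finset.range N, (M * (1 + δ) - (1 + δ)) * ‖p.2 i‖ with hWdef
  obtain ⟨N, hN⟩ : ∃ N, W N p0 < 1 := by
    have h1 := ((aux_l1 p0.2).mul_left (M * (1 + δ) - (1 + δ))).tendsto_sum_nat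
    have h2 := (tendsto_const_nhds (x := M * (1 + δ) * ‖p0.2‖)).sub h1
    have h3 : M * (1 + δ) * ‖p0.2‖ - (M * (1 + δ) - (1 + δ)) * ‖p0.2‖ < 1 := by linarith
    exact (h2.eventually (gt_mem_nhds h3)).exists
  have hWc : Continuous (W N) := by
    have := aux_coord
    simp only [hWdef]
    fun_prop
  set b : ℂ × L1 → (ℕ →₀ ℕ) → ℝ := fun p k => M ^ N * ((k.multinomial : ℝ) * ∏ i ∈ k.support,
      ((if i < N then 1 + δ else M * (1 + δ)) * ‖p.2 i‖) ^ k i) with hbdef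
  have hab : ∀ᶠ p in 𝓝 p0, ∀ k, DeltaTerm p.1 (fun ν => p.2 ν) k ≤ b p k := by
    have : ∀ᶠ p : ℂ × L1 in 𝓝 p0, ‖p.1‖ < Q :=
      (continuous_fst.norm.continuousAt (x := p0)).eventually (gt_mem_nhds (by simp [Q]))
    filter_upwards [this] with p hp k
    exact aux_bound δ Q M hδ hM hMQ N p.1 hp.le (fun ν => p.2 ν) k
  have hb : ∀ k, ContinuousAt (fun p => b p k) p0 := by
    intro k
    have := aux_coord
    apply Continuous.continuousAt
    simp only [hbdef]
    fun_prop
  have hlt : ∀ᶠ p in 𝓝 p0, W N p < 1 := hWc.continuousAt.eventually (gt_mem_nhds hN)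
  have hB : ∀ᶠ p in 𝓝 p0, HasSum (b p) (M ^ N * (1 - W N p)⁻¹) := by
    filter_upwards [hlt] with p hp
    apply HasSum.mul_left
    apply aux_multinomial _ _ _ (aux_W N _ _ p.2) hp
    intro i
    apply mul_nonneg _ (norm_nonneg _)
    split_ifs <;> positivity
  have hBc : ContinuousAt (fun p => M ^ N * (1 - W N p)⁻¹) p0 :=
    continuousAt_const.mul ((continuousAt_const.sub hWc.continuousAt).inv₀ (sub_pos.2 hN).ne')
  have hs : ∀ᶠ p in 𝓝 p0, Summable (DeltaTerm p.1 (fun ν => p.2 ν)) := by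
    filter_upwards [hab, hB] with p h1 h2
    exact Summable.of_nonneg_of_le (aux_nonneg _ _) h1 h2.summable
  exact ⟨hs.self_of_nhds, hs, fun ε hε => aux_tail p0
    (fun p k => DeltaTerm p.1 (fun ν => p.2 ν) k) b _ (fun p k => aux_nonneg _ _ _) hab hb hB hBc ε hε⟩

/-- For every `q ∈ ℂ` and `z` in the open unit ball of `l¹` the family of terms
`(‖k‖^{‖k‖}/k^k)·|q|^{#k}·|z^k|` is summable (so `Δ(q,z)` is well defined and finite), `Δ` is
continuous on `ℂ × B(1)`, and the convergence is uniform on compact subsets of `ℂ × B(1)`. -/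
theorem statement3 :
    (∀ (q : ℂ) (z : L1), ‖z‖ < 1 → Summable (DeltaTerm q (fun ν => z ν))) ∧
    ContinuousOn (fun p : ℂ × L1 => Delta p.1 (fun ν => p.2 ν))
      ((univ : Set ℂ) ×ˢ {z : L1 | ‖z‖ < 1}) ∧
    ∀ K ⊆ (univ : Set ℂ) ×ˢ {z : L1 | ‖z‖ < 1}, IsCompact K → ∀ ε > (0 : ℝ),
      ∃ F : Finset (ℕ →₀ ℕ), ∀ p ∈ K,
        ∑' k : {k : ℕ →₀ ℕ // k ∉ F}, DeltaTerm p.1 (fun ν => p.2 ν) k.1 < ε := by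
  classical
  refine ⟨fun q z hz => (aux_main (q, z) hz).1, ?_, ?_⟩
  · intro p0 hp0
    apply ContinuousAt.continuousWithinAt
    obtain ⟨-, hs, ht⟩ := aux_main p0 hp0.2
    apply continuousAt_of_locally_uniform_approx_of_continuousAt
    intro u hu
    obtain ⟨ε, hε, hεu⟩ := Metric.mem_uniformity_dist.1 hu
    obtain ⟨F, hF⟩ := ht ε hε
    refine ⟨_, hs.and hF, fun p => ∑ k ∈ F, DeltaTerm p.1 (fun ν => p.2 ν) k, ?_, ?_⟩
    · apply Continuous.continuousAt
      have := aux_coord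
      unfold DeltaTerm
      fun_prop
    · rintro p ⟨h1, h2⟩
      apply hεu
      have h3 := h1.sum_add_tsum_subtype_compl F
      have h4 := h2 F subset_rfl
      have h5 : 0 ≤ ∑' k : {k : ℕ →₀ ℕ // k ∉ F}, DeltaTerm p.1 (fun ν => p.2 ν) k.1 :=
        tsum_nonneg fun k => aux_nonneg _ _ _
      rw [Real.dist_eq, Delta, ← h3, add_sub_cancel_left, abs_of_nonneg h5]
      exact h4
  · intro K hK hKc ε hε
    have : ∃ F : Finset (ℕ →₀ ℕ), ∀ p ∈ K, ∀ G, F ⊆ G →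
        ∑' k : {k : ℕ →₀ ℕ // k ∉ G}, DeltaTerm p.1 (fun ν => p.2 ν) k.1 < ε := by
      refine hKc.induction_on (p := fun S => ∃ F : Finset (ℕ →₀ ℕ), ∀ p ∈ S, ∀ G, F ⊆ G →
        ∑' k : {k : ℕ →₀ ℕ // k ∉ G}, DeltaTerm p.1 (fun ν => p.2 ν) k.1 < ε) ?_ ?_ ?_ ?_
      · exact ⟨∅, by simp⟩
      · rintro s t hst ⟨F, hF⟩
        exact ⟨F, fun p hp => hF p (hst hp)⟩
      · rintro s t ⟨F, hF⟩ ⟨F', hF'⟩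
        refine ⟨F ∪ F', fun p hp G hG => ?_⟩
        rcases hp with hp | hp
        · exact hF p hp G (Finset.union_subset_left hG)
        · exact hF' p hp G (Finset.union_subset_right hG)
      · intro p hp
        obtain ⟨F, hF⟩ := (aux_main p (hK hp).2).2.2 ε hε
        exact ⟨_, mem_nhdsWithin_of_mem_nhds hF, F, fun p hp => hp⟩
    obtain ⟨F, hF⟩ := this
    exact ⟨F, fun p hp => hF p hp F subset_rfl⟩
end
end

section
/- Let 0 < R < ∞ and let h be a bounded holomorphic function on the ball B(R) ⊆ l¹, with monomial coefficients (a_k). Then a := sup_k |a_k| R^{‖k‖} k^k/‖k‖^{‖k‖} < ∞, and for every z ∈ B(R) the family (a_k z^k), indexed by multiindices k, is absolutely summable with sum h(z). -/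
open Set
open scoped ENNReal NNReal

noncomputable section

open MeasureTheory in
lemma cauchy_est (S : Finset ℕ) (b : (ℕ →₀ ℕ) → ℂ) (hb : Summable fun j => ‖b j‖)
    (hS : ∀ j, b j ≠ 0 → j.support ⊆ S) (M : ℝ)
    (hM : ∀ u : ℕ → ℂ, (∀ ν, ‖u ν‖ = 1) → ‖∑' j, b j * monom j u‖ ≤ M)
    (k : ℕ →₀ ℕ) (hk : k.support ⊆ S) : ‖b k‖ ≤ M := by
  classical
  let μ : Measure (S → AddCircle (1:ℝ)) :=
    Measure.pi (fun _ : S => AddCircle.haarAddCircle (T := 1))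
  let u : (S → AddCircle (1:ℝ)) → ℕ → ℂ := fun x ν =>
    if h : ν ∈ S then fourier 1 (x ⟨ν, h⟩) else 1
  have hu : ∀ x ν, ‖u x ν‖ = 1 := by
    intro x ν
    by_cases h : ν ∈ S
    · simp only [u, h, dite_true, fourier_apply]; exact Circle.norm_coe _
    · simp [u, h]
  have huc : ∀ ν, Continuous fun x => u x ν := by
    intro ν
    by_cases h : ν ∈ S
    · simp only [u, h, dite_true]; fun_prop
    · simp only [u, h, dite_false]; fun_prop
  let e : (S → AddCircle (1:ℝ)) → ℂ := fun x => ∏ i : S, fourier (-(k i : ℤ)) (x i)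
  have he : ∀ x, ‖e x‖ = 1 := by intro x; simp only [e, norm_prod, fourier_apply]; exact Finset.prod_eq_one fun _ _ => Circle.norm_coe _
  have hec : Continuous e := by simp only [e]; fun_prop
  have hmn : ∀ j x, ‖monom j (u x)‖ = 1 := by
    intro j x; simp [monom, hu]
  have hmc : ∀ j, Continuous fun x => monom j (u x) := by
    intro j; simp only [monom]
    exact continuous_finsetProd _ fun i _ => (huc i).pow _
  let F : (ℕ →₀ ℕ) → (S → AddCircle (1:ℝ)) → ℂ := fun j x => e x * (b j * monom j (u x))
  have hFn : ∀ j x, ‖F j x‖ = ‖b j‖ := by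
    intro j x; simp [F, he, hmn]
  have hFc : ∀ j, Continuous (F j) := fun j => hec.mul (continuous_const.mul (hmc j))
  have hFi : ∀ j, Integrable (F j) μ := fun j =>
    Integrable.of_bound (hFc j).aestronglyMeasurable ‖b j‖ (ae_of_all _ fun x => (hFn j x).le)
  have key := hasSum_integral_of_summable_integral_norm hFi (by simpa [hFn] using hb)
  have hint : ∀ j, ∫ x, F j x ∂μ = if j = k then b k else 0 := by
    intro j
    by_cases hbj : b j = 0
    · by_cases hjk : j = k
      · subst hjk; simp [F, hbj]
      · simp [F, hbj, hjk]
    have hj := hS j hbj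
    have h1 : ∀ x, F j x = b j * ∏ i : S, (fourier (-(k i : ℤ)) (x i) * fourier (j i : ℤ) (x i)) := by
      intro x
      have : monom j (u x) = ∏ i : S, fourier (j i : ℤ) (x i) := by
        have h2 : monom j (u x) = ∏ ν ∈ S, u x ν ^ j ν := by
          refine Finset.prod_subset hj ?_
          intro ν _ hν
          simp [Finsupp.notMem_support_iff.1 hν]
        rw [h2, ← Finset.prod_coe_sort]
        refine Finset.prod_congr rfl fun i _ => ?_
        simp [u, fourier_apply, AddCircle.toCircle_nsmul]
      simp only [F, e, this, Finset.prod_mul_distrib]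
      ring
    simp_rw [h1]
    rw [integral_const_mul]
    have h3 : ∫ x, ∏ i : S, (fourier (-(k i : ℤ)) (x i) * fourier (j i : ℤ) (x i)) ∂μ
        = ∏ i : S, fourierCoeff (T := 1) (fourier (j i : ℤ)) (k i : ℤ) :=
      integral_fintype_prod_eq_prod (𝕜 := ℂ) (E := fun _ : S => AddCircle (1:ℝ))
        (fun (i : S) x => fourier (-(k i : ℤ)) x * fourier (j i : ℤ) x)
    rw [h3]
    by_cases hjk : j = k
    · subst hjk
      simp [fourierCoeff_fourier]
    · rw [if_neg hjk]
      obtain ⟨ν, hν⟩ := Finsupp.ne_iff.1 hjk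
      have hνS : ν ∈ S := by
        by_contra hn
        have h4 := Finsupp.notMem_support_iff.1 (fun h => hn (hj h))
        have h5 := Finsupp.notMem_support_iff.1 (fun h => hn (hk h))
        exact hν (h4.trans h5.symm)
      rw [Finset.prod_eq_zero (Finset.mem_univ (⟨ν, hνS⟩ : S)), mul_zero]
      rw [fourierCoeff_fourier, Pi.single_eq_of_ne]
      simpa using fun h => hν h.symm
  simp_rw [hint] at key
  have h6 := key.unique (hasSum_ite_eq k (b k))
  rw [← h6]
  have h7 : ∀ x, ‖∑' j, F j x‖ ≤ M := by
    intro x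
    simp only [F]
    rw [tsum_mul_left, norm_mul, he, one_mul]
    exact hM _ (hu x)
  have := norm_integral_le_of_norm_le_const (μ := μ) (ae_of_all _ h7)
  simpa using this

lemma summable_multi (w : ℕ → ℝ) (hw : ∀ ν, 0 ≤ w ν) (hs : Summable w) (h1 : ∑' ν, w ν < 1) :
    Summable fun k : ℕ →₀ ℕ => (k.multinomial : ℝ) * ∏ ν ∈ k.support, w ν ^ k ν := by
  classical
  have hq : 0 ≤ ∑' ν, w ν := tsum_nonneg hw
  have hnn : ∀ k : ℕ →₀ ℕ, 0 ≤ (k.multinomial : ℝ) * ∏ ν ∈ k.support, w ν ^ k ν := fun k =>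
    mul_nonneg (Nat.cast_nonneg _) (Finset.prod_nonneg fun ν _ => pow_nonneg (hw ν) _)
  refine summable_of_sum_le (c := ∑' n : ℕ, (∑' ν, w ν) ^ n) hnn ?_
  intro F
  set S := F.biUnion Finsupp.support with hSdef
  rw [← Finset.sum_fiberwise_of_maps_to (t := F.image knormN) (g := knormN)
    (fun k hk => Finset.mem_image_of_mem _ hk)]
  refine le_trans (Finset.sum_le_sum (g := fun n => (∑' ν, w ν) ^ n) ?_)
    ((summable_geometric_of_lt_one hq h1).sum_le_tsum _ (fun n _ => pow_nonneg hq n))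
  intro n _
  refine le_trans ?_ (pow_le_pow_left₀ (Finset.sum_nonneg fun ν _ => hw ν)
    (hs.sum_le_tsum S fun ν _ => hw ν) n)
  rw [Finset.sum_pow_eq_sum_piAntidiag]
  have hsub : ∀ k ∈ F, k.support ⊆ S := fun k hk => Finset.subset_biUnion_of_mem Finsupp.support hk
  calc _ = ∑ k ∈ F.filter (fun k => knormN k = n),
        ((Nat.multinomial S k : ℝ) * ∏ i ∈ S, w i ^ k i) := by
        refine Finset.sum_congr rfl fun k hk => ?_
        have hkS := hsub k (Finset.mem_filter.1 hk).1
        rw [Finsupp.multinomial_eq_of_support_subset hkS]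
        congr 1
        refine Finset.prod_subset hkS ?_
        intro ν _ hν
        simp [Finsupp.notMem_support_iff.1 hν]
    _ = ∑ k ∈ (F.filter (fun k => knormN k = n)).image (fun k : ℕ →₀ ℕ => (k : ℕ → ℕ)),
        ((Nat.multinomial S k : ℝ) * ∏ i ∈ S, w i ^ k i) := by
        rw [Finset.sum_image]
        intro x _ y _ hxy
        exact DFunLike.coe_injective hxy
    _ ≤ _ := by
        refine Finset.sum_le_sum_of_subset_of_nonneg ?_ ?_
        · intro f hf
          obtain ⟨k, hk, rfl⟩ := Finset.mem_image.1 hf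
          obtain ⟨hkF, hkn⟩ := Finset.mem_filter.1 hk
          rw [Finset.mem_piAntidiag]
          refine ⟨?_, ?_⟩
          · rw [← hkn]
            refine (Finset.sum_subset (hsub k hkF) ?_).symm
            intro ν _ hν
            simpa using hν
          · intro i hi
            exact hsub k hkF (by simpa using hi)
        · intro f _ _
          exact mul_nonneg (Nat.cast_nonneg _) (Finset.prod_nonneg fun ν _ => pow_nonneg (hw ν) _)

lemma fact_bound (n : ℕ) (hn : 1 ≤ n) :
    (n.factorial : ℝ) * Real.exp 1 ^ n ≤ Real.exp 1 * n * (n : ℝ) ^ n := by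
  induction n, hn using Nat.le_induction with
  | base => simp
  | succ n hn ih =>
    have hn0 : (0:ℝ) < n := by exact_mod_cast hn
    have h1 : Real.exp 1 * (n : ℝ) ^ (n+1) ≤ ((n : ℝ) + 1) ^ (n+1) := by
      have h2 : (n : ℝ) / (n + 1) ≤ Real.exp (-(1 / ((n:ℝ)+1))) := by
        have := Real.one_sub_le_exp_neg (1 / ((n:ℝ)+1))
        refine le_trans (le_of_eq ?_) this
        field_simp; ring
      have h3 := pow_le_pow_left₀ (by positivity) h2 (n+1)
      rw [← Real.exp_nat_mul] at h3
      have h4 : ((n+1 : ℕ):ℝ) * (-(1 / ((n:ℝ)+1))) = -1 := by push_cast; field_simp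
      rw [h4, Real.exp_neg, div_pow, div_le_iff₀ (by positivity)] at h3
      have h5 := mul_le_mul_of_nonneg_left h3 (Real.exp_pos 1).le
      rw [← mul_assoc, mul_inv_cancel₀ (Real.exp_pos 1).ne', one_mul] at h5
      exact h5
    rw [Nat.factorial_succ]
    push_cast
    calc ((n:ℝ)+1) * n.factorial * Real.exp 1 ^ (n+1)
        = ((n:ℝ)+1) * Real.exp 1 * (n.factorial * Real.exp 1 ^ n) := by ring
      _ ≤ ((n:ℝ)+1) * Real.exp 1 * (Real.exp 1 * n * (n : ℝ) ^ n) := by gcongr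
      _ = ((n:ℝ)+1) * Real.exp 1 * (Real.exp 1 * (n : ℝ) ^ (n+1)) := by ring
      _ ≤ ((n:ℝ)+1) * Real.exp 1 * (((n : ℝ) + 1) ^ (n+1)) := by gcongr
      _ = _ := by ring

lemma kk_pos (k : ℕ →₀ ℕ) : 0 < kk k := by
  refine Finset.prod_pos fun ν hν => ?_
  have : 0 < k ν := Nat.pos_of_ne_zero (by simpa using hν)
  positivity

lemma nn_le (k : ℕ →₀ ℕ) :
    nn k / kk k ≤ k.multinomial * ∏ ν ∈ k.support, (Real.exp 1 * k ν) := by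
  rw [div_le_iff₀ (kk_pos k)]
  have h1 : nn k ≤ Real.exp 1 ^ knormN k * (knormN k).factorial := by
    have := Real.pow_div_factorial_le_exp (x := knormN k) (Nat.cast_nonneg _) (knormN k)
    rw [div_le_iff₀ (by positivity)] at this
    rwa [← Real.exp_nat_mul, mul_one]
  have h2 : ((knormN k).factorial : ℝ) = (∏ ν ∈ k.support, ((k ν).factorial : ℝ)) * k.multinomial := by
    have := Nat.multinomial_spec k.support k
    rw [Finsupp.multinomial_eq, knormN, Finsupp.sum, ← this]
    push_cast; rfl
  have h3 : Real.exp 1 ^ knormN k = ∏ ν ∈ k.support, Real.exp 1 ^ k ν := by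
    rw [knormN, Finsupp.sum, Finset.prod_pow_eq_pow_sum]
  rw [h2, h3] at h1
  refine h1.trans ?_
  calc _ = (k.multinomial : ℝ) * ∏ ν ∈ k.support, (((k ν).factorial : ℝ) * Real.exp 1 ^ k ν) := by
        rw [Finset.prod_mul_distrib]; ring
    _ ≤ (k.multinomial : ℝ) * ∏ ν ∈ k.support, (Real.exp 1 * k ν * (k ν : ℝ) ^ k ν) := by
        refine mul_le_mul_of_nonneg_left ?_ (Nat.cast_nonneg _)
        refine Finset.prod_le_prod (fun _ _ => by positivity) fun ν hν => ?_
        exact fact_bound _ (Nat.pos_of_ne_zero (by simpa using hν))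
    _ = _ := by rw [Finset.prod_mul_distrib, kk]; ring

lemma summable_nnkk (w : ℕ → ℝ) (hw : ∀ ν, 0 ≤ w ν) (hs : Summable w) (h1 : ∑' ν, w ν < 1) :
    Summable fun k : ℕ →₀ ℕ => nn k / kk k * ∏ ν ∈ k.support, w ν ^ k ν := by
  classical
  set q := ∑' ν, w ν with hqdef
  have hq : 0 ≤ q := tsum_nonneg hw
  obtain ⟨A, hA1, hA2, hAq⟩ : ∃ A : ℝ, 1 < A ∧ A ≤ 2 ∧ A * q < 1 := by
    refine ⟨2 / (1 + q), ?_, ?_, ?_⟩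
    · rw [lt_div_iff₀ (by linarith)]; linarith
    · rw [div_le_iff₀ (by linarith)]; linarith
    · rw [div_mul_eq_mul_div, div_lt_iff₀ (by linarith)]; linarith
  obtain ⟨C, hC1, hC⟩ : ∃ C : ℝ, 1 ≤ C ∧ ∀ n : ℕ, Real.exp 1 * n ≤ C * A ^ n := by
    have hA0 : 0 < A - 1 := by linarith
    refine ⟨max 1 (Real.exp 1 / (A - 1)), le_max_left _ _, fun n => ?_⟩
    have hb := one_add_mul_le_pow (a := A - 1) (by linarith) n
    have h2 : (n:ℝ) * (A - 1) ≤ A ^ n := by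
      have : (1 + (A-1)) = A := by ring
      rw [this] at hb; linarith
    calc Real.exp 1 * n = Real.exp 1 / (A - 1) * (n * (A - 1)) := by field_simp
      _ ≤ Real.exp 1 / (A - 1) * A ^ n := by gcongr
      _ ≤ _ := by gcongr; exact le_max_right _ _
  have h6 : ∀ n : ℕ, 1 ≤ n → Real.exp 1 * n ≤ 6 ^ n := by
    intro n hn
    have he : Real.exp 1 ≤ 3 := by linarith [Real.exp_one_lt_d9]
    have h2 : (n:ℝ) ≤ 2 ^ n := by exact_mod_cast Nat.lt_two_pow_self.le
    calc Real.exp 1 * n ≤ 3 ^ 1 * 2 ^ n := by rw [pow_one]; gcongr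
      _ ≤ 3 ^ n * 2 ^ n := by gcongr; norm_num
      _ = 6 ^ n := by rw [← mul_pow]; norm_num
  obtain ⟨T, hT⟩ : ∃ T : Finset ℕ, q - (1 - A * q) / 6 < ∑ ν ∈ T, w ν :=
    (hs.hasSum.eventually (lt_mem_nhds (by linarith : q - (1 - A * q) / 6 < q))).exists
  let w' : ℕ → ℝ := fun ν => if ν ∈ T then A * w ν else 6 * w ν
  have hw' : ∀ ν, 0 ≤ w' ν := by
    intro ν
    have := hw ν
    simp only [w']; split_ifs <;> positivity
  have hsum : HasSum w' (6 * q - ∑ ν ∈ T, (6 - A) * w ν) := by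
    have hh := (hs.hasSum.mul_left 6).sub (hasSum_sum_of_ne_finset_zero
      (f := fun ν => if ν ∈ T then (6 - A) * w ν else 0) (s := T) (fun b hb => by simp [hb]))
    convert! hh using 1
    · ext ν; simp only [w']; split_ifs <;> ring
    · congr 1
      exact Finset.sum_congr rfl fun ν hν => by simp [hν]
  have hlt : ∑' ν, w' ν < 1 := by
    rw [hsum.tsum_eq, ← Finset.mul_sum]
    nlinarith
  have hM := (summable_multi w' hw' hsum.summable hlt).mul_left (C ^ T.card)
  refine Summable.of_nonneg_of_le (fun k => ?_) (fun k => ?_) hM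
  · refine mul_nonneg (div_nonneg (by unfold nn; positivity) (kk_pos k).le)
      (Finset.prod_nonneg fun ν _ => pow_nonneg (hw ν) _)
  · have hp : ∏ ν ∈ k.support, (if ν ∈ T then C else 1) ≤ C ^ T.card := by
      rw [Finset.prod_ite, Finset.prod_const, Finset.prod_const_one, mul_one]
      refine pow_le_pow_right₀ hC1 (Finset.card_le_card ?_)
      intro ν hν
      exact (Finset.mem_filter.1 hν).2
    calc _ ≤ (k.multinomial * ∏ ν ∈ k.support, (Real.exp 1 * k ν)) * ∏ ν ∈ k.support, w ν ^ k ν :=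
          mul_le_mul_of_nonneg_right (nn_le k) (Finset.prod_nonneg fun ν _ => pow_nonneg (hw ν) _)
      _ = k.multinomial * ∏ ν ∈ k.support, (Real.exp 1 * k ν * w ν ^ k ν) := by
          rw [Finset.prod_mul_distrib (f := fun ν => Real.exp 1 * (k ν : ℝ)), mul_assoc]
      _ ≤ k.multinomial * ∏ ν ∈ k.support, ((if ν ∈ T then C else 1) * w' ν ^ k ν) := by
          refine mul_le_mul_of_nonneg_left ?_ (Nat.cast_nonneg _)
          refine Finset.prod_le_prod (fun ν _ => ?_) fun ν hν => ?_
          · have := hw ν; positivity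
          · have hpw : 0 ≤ w ν ^ k ν := pow_nonneg (hw ν) _
            by_cases hνT : ν ∈ T
            · simp only [hνT, w', if_true]
              rw [mul_pow, ← mul_assoc]
              exact mul_le_mul_of_nonneg_right (hC _) hpw
            · simp only [hνT, w', if_false, one_mul]
              rw [mul_pow]
              exact mul_le_mul_of_nonneg_right
                (h6 _ (Nat.pos_of_ne_zero (by simpa using hν))) hpw
      _ = (∏ ν ∈ k.support, (if ν ∈ T then C else 1)) *
            (k.multinomial * ∏ ν ∈ k.support, w' ν ^ k ν) := by
          rw [Finset.prod_mul_distrib]; ring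
      _ ≤ _ := mul_le_mul_of_nonneg_right hp (mul_nonneg (Nat.cast_nonneg _)
            (Finset.prod_nonneg fun ν _ => pow_nonneg (hw' ν) _))

/-- Truncated sequence as an element of `l¹`. -/
def trunc (S : Finset ℕ) (f : ℕ → ℂ) : L1 := ∑ ν ∈ S, lp.single 1 ν (f ν)

lemma trunc_apply (S : Finset ℕ) (f : ℕ → ℂ) (ν : ℕ) :
    (trunc S f) ν = if ν ∈ S then f ν else 0 := by
  simp only [trunc, lp.coeFn_sum, Finset.sum_apply, lp.coeFn_single, Finset.sum_pi_single]

lemma trunc_norm (S : Finset ℕ) (f : ℕ → ℂ) : ‖trunc S f‖ = ∑ ν ∈ S, ‖f ν‖ := by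
  have := lp.norm_sum_single (E := fun _ : ℕ => ℂ) (p := 1) (by simp) f S
  simpa [trunc] using this

lemma trunc_fin (S : Finset ℕ) (f : ℕ → ℂ) : {ν : ℕ | (trunc S f) ν ≠ 0}.Finite := by
  refine S.finite_toSet.subset ?_
  intro ν hν
  by_contra hn
  exact hν (by rw [trunc_apply, if_neg (by simpa using hn)])

lemma monom_trunc (S : Finset ℕ) (f : ℕ → ℂ) (k : ℕ →₀ ℕ) :
    monom k (fun ν => (trunc S f) ν) = if k.support ⊆ S then monom k f else 0 := by
  simp only [trunc_apply]
  split_ifs with hk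
  · exact Finset.prod_congr rfl fun ν hν => by simp only [if_pos (hk hν)]
  · obtain ⟨ν, hν, hνS⟩ := Finset.not_subset.1 hk
    refine Finset.prod_eq_zero hν ?_
    simp only [if_neg hνS]
    exact zero_pow (by simpa using hν)

lemma coeff_bound (R : ℝ) (h : L1 → ℂ) (M : ℝ) (hM : ∀ z : L1, ‖z‖ < R → ‖h z‖ ≤ M)
    (a : (ℕ →₀ ℕ) → ℂ)
    (ha : ∀ z : L1, ‖z‖ < R → {ν : ℕ | z ν ≠ 0}.Finite →
      Summable (fun k => ‖a k * monom k (fun ν => z ν)‖) ∧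
      HasSum (fun k => a k * monom k (fun ν => z ν)) (h z))
    (k : ℕ →₀ ℕ) (r : ℕ → ℝ) (hr : ∀ ν, 0 ≤ r ν) (hrR : ∑ ν ∈ k.support, r ν < R) :
    ‖a k‖ * ∏ ν ∈ k.support, r ν ^ k ν ≤ M := by
  have hn : ∀ u : ℕ → ℂ, (∀ ν, ‖u ν‖ = 1) → ‖trunc k.support (fun ν => r ν * u ν)‖ < R := by
    intro u hu
    rw [trunc_norm]
    refine lt_of_eq_of_lt (Finset.sum_congr rfl fun ν _ => ?_) hrR
    simp [hu, abs_of_nonneg (hr ν)]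
  have hmul : ∀ (j : ℕ →₀ ℕ) (u : ℕ → ℂ), monom j (fun ν => (trunc k.support (fun ν => r ν * u ν)) ν)
      = (if j.support ⊆ k.support then monom j (fun ν => (r ν : ℂ)) else 0) * monom j u := by
    intro j u
    rw [monom_trunc]
    split_ifs
    · simp [monom, mul_pow, Finset.prod_mul_distrib]
    · simp
  let b : (ℕ →₀ ℕ) → ℂ := fun j =>
    a j * (if j.support ⊆ k.support then monom j (fun ν => (r ν : ℂ)) else 0)
  have hb := cauchy_est k.support b ?_ ?_ M ?_ k subset_rfl
  · simpa [b, monom, abs_of_nonneg, hr] using hb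
  · have := (ha _ (hn (fun _ => 1) (by simp)) (trunc_fin _ _)).1
    simp_rw [hmul] at this
    simpa [b, monom] using this
  · intro j hj
    by_contra hns
    exact hj (by simp [b, hns])
  · intro u hu
    have := (ha _ (hn u hu) (trunc_fin _ _)).2
    simp_rw [hmul, ← mul_assoc] at this
    have h2 : ∑' j, b j * monom j u = _ := this.tsum_eq
    rw [h2]
    exact hM _ (hn u hu)

/-- Let `0 < R < ∞` and let `h` be a bounded holomorphic function on
`B(R) ⊆ l¹` with monomial coefficients `(a_k)` (characterized by absolute summability with sum
`h(z)` at points with finitely many nonzero coordinates). Then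
`a := sup_k |a_k| R^{‖k‖} k^k/‖k‖^{‖k‖} < ∞` and for every `z ∈ B(R)` the family `(a_k z^k)`
is absolutely summable with sum `h(z)`. -/
theorem statement6 (R : ℝ) (hR : 0 < R) (h : L1 → ℂ)
    (hol : DifferentiableOn ℂ h {z : L1 | ‖z‖ < R})
    (hbd : ∃ M : ℝ, ∀ z : L1, ‖z‖ < R → ‖h z‖ ≤ M)
    (a : (ℕ →₀ ℕ) → ℂ)
    (ha : ∀ z : L1, ‖z‖ < R → {ν : ℕ | z ν ≠ 0}.Finite →
      Summable (fun k => ‖a k * monom k (fun ν => z ν)‖) ∧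
      HasSum (fun k => a k * monom k (fun ν => z ν)) (h z)) :
    BddAbove (Set.range fun k : ℕ →₀ ℕ => ‖a k‖ * R ^ knormN k * kk k / nn k) ∧
    ∀ z : L1, ‖z‖ < R →
      Summable (fun k => ‖a k * monom k (fun ν => z ν)‖) ∧
      HasSum (fun k => a k * monom k (fun ν => z ν)) (h z) := by
  classical
  obtain ⟨M, hM⟩ := hbd
  have hnnpos : ∀ k, 0 < nn k := by
    intro k
    unfold nn
    rcases Nat.eq_zero_or_pos (knormN k) with h0 | h0
    · simp [h0]
    · positivity
  have hsum : ∀ k : ℕ →₀ ℕ, ∑ ν ∈ k.support, (k ν : ℝ) = knormN k := by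
    intro k; simp [knormN, Finsupp.sum]
  have hB : ∀ k : ℕ →₀ ℕ, ‖a k‖ * R ^ knormN k * kk k / nn k ≤ M := by
    intro k
    have h1 : ∀ s : ℝ, 0 < s → s < R → ‖a k‖ * s ^ knormN k * kk k / nn k ≤ M := by
      intro s hs hsR
      have := coeff_bound R h M hM a ha k (fun ν => s * k ν / knormN k)
        (fun ν => by positivity) (by
          rw [← Finset.sum_div, ← Finset.mul_sum, hsum]
          by_cases h0 : (knormN k : ℝ) = 0
          · simp [h0, hR]
          · rw [mul_div_assoc, div_self h0, mul_one]; exact hsR)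
      refine le_trans (le_of_eq ?_) this
      have h2 : ∀ c : ℝ, ∏ ν ∈ k.support, c ^ k ν = c ^ knormN k := by
        intro c; rw [Finset.prod_pow_eq_pow_sum]; rfl
      simp only [div_pow, mul_pow, Finset.prod_div_distrib, Finset.prod_mul_distrib, h2, kk, nn]
      ring
    have hc : Continuous fun s : ℝ => ‖a k‖ * s ^ knormN k * kk k / nn k := by fun_prop
    refine le_of_tendsto (hc.continuousWithinAt (s := Set.Iio R) (x := R)) ?_
    filter_upwards [Ioo_mem_nhdsLT hR] with s hs
    exact h1 s hs.1 hs.2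
  refine ⟨⟨M, ?_⟩, ?_⟩
  · rintro _ ⟨k, rfl⟩
    exact hB k
  intro z hz
  have hzs : HasSum (fun ν => ‖z ν‖) ‖z‖ := by
    simpa using lp.hasSum_norm (p := 1) (by simp) z
  have hS : Summable (fun k => ‖a k * monom k (fun ν => z ν)‖) := by
    have h1 := (summable_nnkk (fun ν => ‖z ν‖ / R) (fun ν => by positivity)
      (hzs.summable.div_const R) (by rw [(hzs.div_const R).tsum_eq, div_lt_one hR]; exact hz)).mul_left M
    refine Summable.of_nonneg_of_le (fun k => norm_nonneg _) (fun k => ?_) h1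
    have h2 : ∏ ν ∈ k.support, (‖z ν‖ / R) ^ k ν = ‖monom k (fun ν => z ν)‖ / R ^ knormN k := by
      simp only [div_pow, Finset.prod_div_distrib, monom, norm_prod, norm_pow]
      rw [Finset.prod_pow_eq_pow_sum]; rfl
    rw [h2, norm_mul]
    have hkp := kk_pos k
    have hnp := hnnpos k
    calc ‖a k‖ * ‖monom k (fun ν => z ν)‖
        = (‖a k‖ * R ^ knormN k * kk k / nn k) *
          (nn k / kk k * (‖monom k (fun ν => z ν)‖ / R ^ knormN k)) := by field_simp
      _ ≤ _ := mul_le_mul_of_nonneg_right (hB k) (by positivity)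
  refine ⟨hS, ?_⟩
  have ht : Filter.Tendsto (fun S : Finset ℕ => trunc S (fun ν => z ν)) Filter.atTop (nhds z) :=
    lp.hasSum_single (E := fun _ : ℕ => ℂ) (p := 1) (by simp) z
  have hopen : IsOpen {z : L1 | ‖z‖ < R} := isOpen_lt continuous_norm continuous_const
  have hcont : ContinuousAt h z := (hol.differentiableAt (hopen.mem_nhds hz)).continuousAt
  have hlim := hcont.tendsto.comp ht
  have hlim2 : Filter.Tendsto (fun S : Finset ℕ => ∑' k, a k * monom k (fun ν => (trunc S (fun ν => z ν)) ν))
      Filter.atTop (nhds (∑' k, a k * monom k (fun ν => z ν))) := by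
    refine tendsto_tsum_of_dominated_convergence hS (fun k => ?_) (Filter.Eventually.of_forall fun S k => ?_)
    · refine tendsto_const_nhds.congr' ?_
      filter_upwards [Filter.eventually_ge_atTop k.support] with S hkS
      rw [monom_trunc, if_pos hkS]
    · rw [monom_trunc]
      split_ifs
      · exact le_rfl
      · rw [mul_zero, norm_zero]; exact norm_nonneg _
  have heq : ∀ S : Finset ℕ, ∑' k, a k * monom k (fun ν => (trunc S (fun ν => z ν)) ν)
      = h (trunc S (fun ν => z ν)) := by
    intro S
    refine (ha _ ?_ (trunc_fin _ _)).2.tsum_eq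
    rw [trunc_norm]
    exact (sum_le_hasSum S (fun ν _ => norm_nonneg _) hzs).trans_lt hz
  simp_rw [heq] at hlim2
  have := tendsto_nhds_unique hlim2 hlim
  rw [← this]
  exact hS.of_norm.hasSum
end
end

section
/- Let 0 < R ≤ ∞ and let (a_k), indexed by multiindices k, be complex numbers such that for every sequence σ = (σ_ν) of reals with 0 ≤ σ_ν < R and σ_ν → 0 the quantities |a_k| σ^k k^k/‖k‖^{‖k‖} tend to 0 along the cofinite filter on the set of multiindices. Then there exists a holomorphic function h on B(R) ⊆ l¹ whose monomial coefficients are (a_k); in particular, for every z ∈ B(R) the family (a_k z^k) is absolutely summable with sum h(z). -/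
open Set
open scoped ENNReal NNReal

noncomputable section

lemma aux_diff {V : Type*} [NormedAddCommGroup V] [NormedSpace ℂ V] {ι : Type*}
    {l : Filter ι} [l.NeBot] (f : ι → V → ℂ) (hf : ∀ i, Differentiable ℂ (f i))
    (c : V) (δ M : ℝ) (hδ : 0 < δ) (hM : ∀ i, ∀ z ∈ Metric.ball c δ, ‖f i z‖ ≤ M)
    (h : V → ℂ) (hh : ∀ z ∈ Metric.ball c δ, Filter.Tendsto (fun i => f i z) l (nhds (h z))) :
    DifferentiableAt ℂ h c := by
  classical
  have hc : c ∈ Metric.ball c δ := Metric.mem_ball_self hδ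
  have hmaps : ∀ i, MapsTo (f i) (Metric.ball c δ) (Metric.closedBall (f i c) (2 * M)) := by
    intro i z hz
    rw [mem_closedBall_iff_norm]
    calc ‖f i z - f i c‖ ≤ ‖f i z‖ + ‖f i c‖ := norm_sub_le _ _
      _ ≤ 2 * M := by linarith [hM i z hz, hM i c hc]
  have hD : ∀ i, ‖fderiv ℂ (f i) c‖ ≤ 2 * M / δ := fun i =>
    Complex.norm_fderiv_le_div_of_mapsTo_ball (hf i).differentiableOn (hmaps i) hδ
  have key : ∀ i, ∀ z ∈ Metric.ball c δ,
      ‖f i z - f i c - fderiv ℂ (f i) c (z - c)‖ ≤ 4 * M * (‖z - c‖ / δ) ^ 2 := by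
    intro i z hz
    have := Complex.dist_le_mul_div_pow_of_mapsTo_ball_of_isLittleO
      (f := fun z => f i z - fderiv ℂ (f i) c (z - c)) (c := c) (z := z) (R₁ := δ) (R₂ := 4 * M)
      (n := 1) ?_ ?_ ?_ hz
    · rw [dist_eq_norm, dist_eq_norm] at this
      refine le_trans (le_of_eq ?_) this
      congr 1
      simp
      ring
    · exact ((hf i).sub ((fderiv ℂ (f i) c).differentiable.comp
        (differentiable_id.sub_const c))).differentiableOn
    · intro w hw
      rw [mem_closedBall_iff_norm]
      have h1 : ‖fderiv ℂ (f i) c (w - c)‖ ≤ 2 * M := by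
        have hw' : ‖w - c‖ ≤ δ := by
          rw [mem_ball_iff_norm] at hw; exact hw.le
        calc _ ≤ ‖fderiv ℂ (f i) c‖ * ‖w - c‖ := ContinuousLinearMap.le_opNorm _ _
          _ ≤ 2 * M / δ * δ := mul_le_mul (hD i) hw' (norm_nonneg _)
              ((norm_nonneg _).trans (hD i))
          _ = 2 * M := by field_simp
      have h2 := hmaps i hw
      rw [mem_closedBall_iff_norm] at h2
      calc ‖f i w - fderiv ℂ (f i) c (w - c) - (f i c - fderiv ℂ (f i) c (c - c))‖
          = ‖(f i w - f i c) - fderiv ℂ (f i) c (w - c)‖ := by congr 1; simp; ring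
        _ ≤ _ := norm_sub_le _ _
        _ ≤ 4 * M := by linarith
    · have := (hf i c).hasFDerivAt.isLittleO
      have h2 := (this.norm_right).congr_left (f₂ := fun x => f i x - (fderiv ℂ (f i) c) (x - c) -
        (f i c - (fderiv ℂ (f i) c) (c - c))) (fun w => by simp; ring)
      simpa only [pow_one] using h2
  obtain ⟨U, hU⟩ : ∃ U : Ultrafilter ι, (U : Filter ι) ≤ l := ⟨Ultrafilter.of l, Ultrafilter.of_le l⟩
  have hcomp := WeakDual.isCompact_closedBall (𝕜 := ℂ) (E := V) 0 (2 * M / δ)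
  obtain ⟨L, -, hL⟩ := hcomp.ultrafilter_le_nhds
    (U.map (fun i => StrongDual.toWeakDual (fderiv ℂ (f i) c))) (by
      rw [Filter.le_principal_iff]
      refine Filter.univ_mem' (f := (U : Filter ι)) ?_
      intro i
      simpa using hD i)
  have hL' : ∀ v, Filter.Tendsto (fun i => fderiv ℂ (f i) c v) U (nhds (L v)) := by
    intro v
    have h1 : Filter.Tendsto (fun i => StrongDual.toWeakDual (fderiv ℂ (f i) c)) U (nhds L) := hL
    exact ((WeakDual.eval_continuous v).tendsto L).comp h1
  have fin : ∀ z ∈ Metric.ball c δ,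
      ‖h z - h c - WeakDual.toStrongDual L (z - c)‖ ≤ 4 * M * (‖z - c‖ / δ) ^ 2 := by
    intro z hz
    have t : Filter.Tendsto (fun i => f i z - f i c - fderiv ℂ (f i) c (z - c)) U
        (nhds (h z - h c - WeakDual.toStrongDual L (z - c))) :=
      (((hh z hz).mono_left hU).sub ((hh c hc).mono_left hU)).sub (hL' _)
    exact le_of_tendsto t.norm (Filter.Eventually.of_forall fun i => key i z hz)
  refine ⟨WeakDual.toStrongDual L, ?_⟩
  rw [hasFDerivAt_iff_isLittleO]
  have hO : (fun z => h z - h c - WeakDual.toStrongDual L (z - c)) =O[nhds c]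
      fun z => ‖z - c‖ ^ 2 := by
    refine Asymptotics.IsBigO.of_bound (4 * M / δ ^ 2) ?_
    filter_upwards [Metric.ball_mem_nhds c hδ] with z hz
    refine (fin z hz).trans (le_of_eq ?_)
    simp
    ring
  refine hO.trans_isLittleO ?_
  have : (fun z : V => ‖z - c‖ ^ 2) =o[nhds c] fun z => ‖z - c‖ ^ 1 := by
    have h0 := (Asymptotics.isLittleO_pow_pow (𝕜 := ℝ) (m := 1) (n := 2) (by norm_num))
    refine h0.comp_tendsto ?_
    have : Filter.Tendsto (fun z : V => ‖z - c‖) (nhds c) (nhds ‖c - c‖) :=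
      Continuous.tendsto (by fun_prop) c
    simpa using this
  simpa using this

/-- Banach-type lemma. -/
lemma aux_eps (R : ℝ≥0∞) (a : (ℕ →₀ ℕ) → ℂ)
    (ha : ∀ σ : ℕ → ℝ, (∀ ν, 0 ≤ σ ν) → (∀ ν, ENNReal.ofReal (σ ν) < R) →
      Filter.Tendsto σ Filter.atTop (nhds 0) →
      ∀ ε > (0 : ℝ),
        {k : ℕ →₀ ℕ | ε ≤ ‖a k‖ * (∏ ν ∈ k.support, σ ν ^ k ν) * kk k / nn k}.Finite)
    (σ : ℕ → ℝ) (r d : ℝ) (hd : 0 < d) (hr : ENNReal.ofReal (r + d) < R)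
    (h0 : ∀ ν, 0 ≤ σ ν) (h1 : ∀ ν, σ ν ≤ r)
    (ht : Filter.Tendsto σ Filter.atTop (nhds 0)) :
    ∃ ε > 0, ∃ C : ℝ, ∀ k : ℕ →₀ ℕ,
      ‖a k‖ * (∏ ν ∈ k.support, (σ ν + ε) ^ k ν) * kk k / nn k ≤ C := by
  classical
  by_contra! hcon
  have hk : ∀ j : ℕ, ∃ k : ℕ →₀ ℕ, (j : ℝ) <
      ‖a k‖ * (∏ ν ∈ k.support, (σ ν + d / (j + 1)) ^ k ν) * kk k / nn k :=
    fun j => hcon (d / (j + 1)) (by positivity) j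
  choose K hK using hk
  let Mx : ℕ → ℕ := fun j => j + ∑ i ∈ Finset.range (j + 1), ((K i).support.sup id + 1)
  have hMx : ∀ j, ∀ ν ∈ (K j).support, ν < Mx j := by
    intro j ν hν
    have e1 : ν ≤ (K j).support.sup id := Finset.le_sup (f := id) hν
    have e2 : (K j).support.sup id + 1 ≤
        ∑ i ∈ Finset.range (j + 1), ((K i).support.sup id + 1) :=
      Finset.single_le_sum (f := fun i => (K i).support.sup id + 1) (fun _ _ => Nat.zero_le _)
        (Finset.mem_range.2 (Nat.lt_succ_self j))
    simp only [Mx]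
    omega
  have hex : ∀ ν, ∃ j, ν < Mx j := by
    intro ν
    refine ⟨ν, ?_⟩
    have e2 : (K ν).support.sup id + 1 ≤
        ∑ i ∈ Finset.range (ν + 1), ((K i).support.sup id + 1) :=
      Finset.single_le_sum (f := fun i => (K i).support.sup id + 1) (fun _ _ => Nat.zero_le _)
        (Finset.mem_range.2 (Nat.lt_succ_self ν))
    simp only [Mx]
    omega
  let J : ℕ → ℕ := fun ν => Nat.find (hex ν)
  have hJle : ∀ j ν, ν < Mx j → J ν ≤ j := fun j ν h => Nat.find_min' _ h
  have hJlt : ∀ ν, ν < Mx (J ν) := fun ν => Nat.find_spec (hex ν)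
  have hMm : Monotone Mx := by
    intro i j hij
    have : ∑ i ∈ Finset.range (i + 1), ((K i).support.sup id + 1) ≤
        ∑ i ∈ Finset.range (j + 1), ((K i).support.sup id + 1) :=
      Finset.sum_le_sum_of_subset (Finset.range_mono (by omega))
    simp only [Mx]
    omega
  have hJt : Filter.Tendsto J Filter.atTop Filter.atTop := by
    rw [Filter.tendsto_atTop_atTop]
    intro b
    refine ⟨Mx b, fun ν hν => ?_⟩
    by_contra! hlt
    have := hMm hlt.le
    have := hJlt ν
    omega
  let τ : ℕ → ℝ := fun ν => σ ν + d / (J ν + 1)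
  have hfin := ha τ (fun ν => by have := h0 ν; simp only [τ]; positivity)
    (fun ν => lt_of_le_of_lt (ENNReal.ofReal_le_ofReal (by
      simp only [τ]
      have : d / ((J ν : ℝ) + 1) ≤ d := div_le_self hd.le (by linarith [(J ν).cast_nonneg (α := ℝ)])
      linarith [h1 ν])) hr)
    (by
      have h2 : Filter.Tendsto (fun ν => d / ((J ν : ℝ) + 1)) Filter.atTop (nhds 0) := by
        have h3 : Filter.Tendsto (fun n : ℕ => d / ((n : ℝ) + 1)) Filter.atTop (nhds 0) := by
          have := (tendsto_one_div_add_atTop_nhds_zero_nat (𝕜 := ℝ)).const_mul d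
          simpa [mul_one_div, div_eq_mul_inv] using this
        exact h3.comp hJt
      simpa using ht.add h2) 1 one_pos
  let val : (ℕ →₀ ℕ) → ℝ := fun k => ‖a k‖ * (∏ ν ∈ k.support, τ ν ^ k ν) * kk k / nn k
  have hval : ∀ j : ℕ, (j : ℝ) < val (K j) := by
    intro j
    refine (hK j).trans_le ?_
    have hkk : 0 ≤ kk (K j) := Finset.prod_nonneg fun _ _ => by positivity
    have hnn : 0 ≤ nn (K j) := by unfold nn; positivity
    simp only [val]
    have hp : (∏ ν ∈ (K j).support, (σ ν + d / (j + 1)) ^ (K j) ν) ≤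
        ∏ ν ∈ (K j).support, τ ν ^ (K j) ν := by
      refine Finset.prod_le_prod (fun ν _ => by have := h0 ν; positivity) fun ν hν => ?_
      have hJ : (J ν : ℝ) ≤ j := by exact_mod_cast hJle j ν (hMx j ν hν)
      have := h0 ν
      simp only [τ]
      gcongr
    gcongr
  obtain ⟨B, hB⟩ := (hfin.image val).bddAbove
  obtain ⟨j, hj⟩ := exists_nat_gt (max B 1)
  have h3 : val (K j) ≤ B := hB ⟨K j, by
    show 1 ≤ val (K j)
    linarith [hval j, le_max_right B 1], rfl⟩
  linarith [hval j, le_max_left B 1]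

lemma aux_fact (m : ℕ) (hm : 1 ≤ m) :
    (m.factorial : ℝ) * Real.exp m ≤ Real.exp 1 * m * (m : ℝ) ^ m := by
  induction m, hm using Nat.le_induction with
  | base => simp
  | succ m hm ih =>
    have hm0 : (0 : ℝ) < m := by exact_mod_cast hm
    have h1 : Real.exp 1 * (m : ℝ) ^ (m + 1) ≤ ((m : ℝ) + 1) ^ (m + 1) := by
      have h2 := Real.one_sub_div_pow_le_exp_neg (n := m + 1) (t := 1) (by push_cast; linarith)
      have h3 : (1 - 1 / ((m + 1 : ℕ) : ℝ)) = m / (m + 1) := by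
        push_cast; field_simp; ring
      rw [h3, div_pow, div_le_iff₀ (by positivity), Real.exp_neg] at h2
      calc Real.exp 1 * (m : ℝ) ^ (m + 1)
          ≤ Real.exp 1 * ((Real.exp 1)⁻¹ * ((m : ℝ) + 1) ^ (m + 1)) := by gcongr
        _ = _ := by field_simp
    rw [Nat.factorial_succ]
    push_cast
    rw [Real.exp_add]
    calc ((m : ℝ) + 1) * m.factorial * (Real.exp m * Real.exp 1)
        = ((m : ℝ) + 1) * Real.exp 1 * (m.factorial * Real.exp m) := by ring
      _ ≤ ((m : ℝ) + 1) * Real.exp 1 * (Real.exp 1 * m * (m : ℝ) ^ m) := by gcongr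
      _ = Real.exp 1 * (m + 1) * (Real.exp 1 * (m : ℝ) ^ (m + 1)) := by ring
      _ ≤ _ := by gcongr

lemma aux_t1 (η : ℝ) (h0 : 0 < η) (h1 : η ≤ 1) (m : ℕ) :
    (m.factorial : ℝ) * Real.exp m ≤ Real.exp 1 / η * (1 + η) ^ m * (m : ℝ) ^ m := by
  rcases Nat.eq_zero_or_pos m with rfl | hm
  · simp
    rw [le_div_iff₀ h0]
    linarith [Real.add_one_le_exp 1]
  · refine (aux_fact m hm).trans ?_
    have := one_add_mul_le_pow (a := η) (by linarith) m
    have h2 : (m : ℝ) ≤ (1 + η) ^ m / η := by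
      rw [le_div_iff₀ h0]; linarith
    calc Real.exp 1 * m * (m : ℝ) ^ m ≤ Real.exp 1 * ((1 + η) ^ m / η) * (m : ℝ) ^ m := by gcongr
      _ = _ := by ring

lemma aux_t2 (m : ℕ) :
    (m.factorial : ℝ) * Real.exp m ≤ 1 * (2 * Real.exp 1) ^ m * (m : ℝ) ^ m := by
  rcases Nat.eq_zero_or_pos m with rfl | hm
  · simp
  · refine (aux_fact m hm).trans ?_
    have h2 : (m : ℝ) ≤ 2 ^ m := by exact_mod_cast Nat.lt_two_pow_self.le
    have h3 : Real.exp 1 ≤ Real.exp 1 ^ m :=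
      le_self_pow₀ (by linarith [Real.add_one_le_exp 1]) (by omega)
    rw [one_mul, mul_pow, mul_comm ((2 : ℝ) ^ m)]
    gcongr

/-- scaling factor -/
def dfac (η : ℝ) (N : ℕ) (ν : ℕ) : ℝ := if ν < N then 1 + η else 2 * Real.exp 1

lemma aux_coef (η : ℝ) (h0 : 0 < η) (h1 : η ≤ 1) (N : ℕ) (k : ℕ →₀ ℕ) :
    nn k ≤ (Real.exp 1 / η) ^ N * (Nat.multinomial k.support k : ℝ) *
      (∏ ν ∈ k.support, dfac η N ν ^ k ν) * kk k := by
  have hsum : knormN k = ∑ ν ∈ k.support, k ν := rfl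
  have hspec := Nat.multinomial_spec k.support k
  rw [← hsum] at hspec
  have hspec' : (∏ ν ∈ k.support, ((k ν).factorial : ℝ)) * (Nat.multinomial k.support k : ℝ)
      = ((knormN k).factorial : ℝ) := by exact_mod_cast hspec
  have hKge : 1 ≤ Real.exp 1 / η := by
    rw [le_div_iff₀ h0]; linarith [Real.add_one_le_exp 1]
  have hA : nn k ≤ ((knormN k).factorial : ℝ) * Real.exp (knormN k) := by
    have := Real.pow_div_factorial_le_exp (knormN k : ℝ) (by positivity) (knormN k)
    rw [div_le_iff₀ (by positivity)] at this
    unfold nn; linarith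
  have hB : Real.exp (knormN k) = ∏ ν ∈ k.support, Real.exp (k ν) := by
    rw [← Real.exp_sum, hsum]; push_cast; rfl
  have hC : ∏ ν ∈ k.support, (((k ν).factorial : ℝ) * Real.exp (k ν)) ≤
      ∏ ν ∈ k.support, ((if ν < N then Real.exp 1 / η else 1) * dfac η N ν ^ k ν * (k ν : ℝ) ^ k ν) := by
    refine Finset.prod_le_prod (fun _ _ => by positivity) fun ν _ => ?_
    unfold dfac
    split_ifs
    · exact aux_t1 η h0 h1 _
    · exact aux_t2 _
  have hD : ∏ ν ∈ k.support, (if ν < N then Real.exp 1 / η else 1) ≤ (Real.exp 1 / η) ^ N := by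
    rw [Finset.prod_ite]
    simp only [Finset.prod_const, mul_one, one_pow]
    refine pow_le_pow_right₀ hKge ?_
    calc _ ≤ (Finset.range N).card := Finset.card_le_card (by intro x; simp)
      _ = N := Finset.card_range N
  have hd0 : ∀ ν, 0 ≤ dfac η N ν := by intro ν; unfold dfac; split_ifs <;> positivity
  have hkk : 0 ≤ kk k := Finset.prod_nonneg fun _ _ => by positivity
  have hdp : 0 ≤ ∏ ν ∈ k.support, dfac η N ν ^ k ν :=
    Finset.prod_nonneg fun ν _ => pow_nonneg (hd0 ν) _
  rw [Finset.prod_mul_distrib, Finset.prod_mul_distrib, Finset.prod_mul_distrib, ← hB] at hC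
  calc nn k ≤ ((knormN k).factorial : ℝ) * Real.exp (knormN k) := hA
    _ = (Nat.multinomial k.support k : ℝ) *
        ((∏ ν ∈ k.support, ((k ν).factorial : ℝ)) * Real.exp (knormN k)) := by
        rw [← hspec']; ring
    _ ≤ (Nat.multinomial k.support k : ℝ) * ((∏ ν ∈ k.support,
          (if ν < N then Real.exp 1 / η else 1)) * (∏ ν ∈ k.support, dfac η N ν ^ k ν) *
            ∏ ν ∈ k.support, (k ν : ℝ) ^ k ν) := by gcongr
    _ ≤ (Nat.multinomial k.support k : ℝ) * ((Real.exp 1 / η) ^ N *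
          (∏ ν ∈ k.support, dfac η N ν ^ k ν) * kk k) := by
        unfold kk at *; gcongr
    _ = _ := by ring

lemma aux_multi (u : ℕ → ℝ) (hu : ∀ ν, 0 ≤ u ν) (q : ℝ) (hq0 : 0 ≤ q) (hq : q < 1)
    (hS : ∀ S : Finset ℕ, ∑ ν ∈ S, u ν ≤ q) (F : Finset (ℕ →₀ ℕ)) :
    ∑ k ∈ F, (Nat.multinomial k.support k : ℝ) * ∏ ν ∈ k.support, u ν ^ k ν ≤ (1 - q)⁻¹ := by
  classical
  set S : Finset ℕ := F.biUnion Finsupp.support with hSdef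
  have hsub : ∀ k ∈ F, k.support ⊆ S := fun k hk => Finset.subset_biUnion_of_mem _ hk
  let g : (ℕ → ℕ) → ℝ := fun f => (Nat.multinomial S f : ℝ) * ∏ ν ∈ S, u ν ^ f ν
  have hg : ∀ k ∈ F, (Nat.multinomial k.support k : ℝ) * ∏ ν ∈ k.support, u ν ^ k ν = g k := by
    intro k hk
    have e1 : ∏ ν ∈ k.support, u ν ^ k ν = ∏ ν ∈ S, u ν ^ k ν :=
      Finset.prod_subset (hsub k hk) fun ν _ hν => by
        rw [Finsupp.notMem_support_iff.1 hν, pow_zero]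
    have e2 : Nat.multinomial k.support k = Nat.multinomial S k :=
      Nat.multinomial_congr_of_eq_on_inter
        (by intro a h1; exact absurd (hsub k hk (Finset.mem_sdiff.1 h1).1) (Finset.mem_sdiff.1 h1).2)
        (by intro a h1; exact Finsupp.notMem_support_iff.1 (Finset.mem_sdiff.1 h1).2)
        (by intros; rfl)
    simp only [g]
    rw [e1, e2]
  rw [Finset.sum_congr rfl hg, ← Finset.sum_fiberwise_of_maps_to
    (t := F.image knormN) (g := knormN) (fun k hk => Finset.mem_image_of_mem _ hk)]
  have hn : ∀ n, ∑ k ∈ F with knormN k = n, g k ≤ q ^ n := by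
    intro n
    have hinj : ∑ k ∈ F with knormN k = n, g k =
        ∑ f ∈ (F.filter (fun k => knormN k = n)).image (fun k : ℕ →₀ ℕ => (k : ℕ → ℕ)), g f := by
      rw [Finset.sum_image]
      intro x _ y _ h
      exact DFunLike.coe_injective h
    rw [hinj]
    calc _ ≤ ∑ f ∈ S.piAntidiag n, g f := by
          refine Finset.sum_le_sum_of_subset_of_nonneg ?_ ?_
          · intro f hf
            simp only [Finset.mem_image, Finset.mem_filter] at hf
            obtain ⟨k, ⟨hk, hkn⟩, rfl⟩ := hf
            rw [Finset.mem_piAntidiag]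
            refine ⟨?_, fun i hi => hsub k hk (Finsupp.mem_support_iff.2 hi)⟩
            rw [← hkn]
            symm
            exact Finset.sum_subset (hsub k hk) fun ν _ hν => Finsupp.notMem_support_iff.1 hν
          · intro f _ _
            exact mul_nonneg (by positivity) (Finset.prod_nonneg fun ν _ => pow_nonneg (hu ν) _)
      _ = (∑ ν ∈ S, u ν) ^ n := (Finset.sum_pow_eq_sum_piAntidiag S u n).symm
      _ ≤ q ^ n := pow_le_pow_left₀ (Finset.sum_nonneg fun ν _ => hu ν) (hS S) n
  exact (Finset.sum_le_sum fun n _ => hn n).trans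
    (sum_le_hasSum _ (fun n _ => pow_nonneg hq0 n) (hasSum_geometric_of_lt_one hq0 hq))

lemma aux_c (b : ℕ → ℝ) (hb : ∀ ν, 0 ≤ b ν) (hs : Summable b) :
    ∃ c : ℕ → ℝ, (∀ ν, 0 < c ν) ∧ Filter.Tendsto c Filter.atTop Filter.atTop ∧
      Summable (fun ν => b ν * c ν) := by
  let b' : ℕ → ℝ := fun ν => b ν + (1 / 2) ^ ν
  have hb' : ∀ ν, 0 < b' ν := fun ν => by have := hb ν; simp only [b']; positivity
  have hs' : Summable b' := hs.add summable_geometric_two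
  let T : ℕ → ℝ := fun n => ∑' i, b' (i + n)
  have hsn : ∀ n, Summable (fun i => b' (i + n)) := fun n => (summable_nat_add_iff n).2 hs'
  have hT : ∀ n, 0 < T n := fun n => (hsn n).tsum_pos (fun i => (hb' _).le) 0 (hb' _)
  have hTs : ∀ n, T n = b' n + T (n + 1) := by
    intro n
    simp only [T]
    rw [(hsn n).tsum_eq_zero_add]
    simp only [zero_add]
    congr 2
    ext i
    congr 1
    ring
  have hT0 : Filter.Tendsto T Filter.atTop (nhds 0) := tendsto_sum_nat_add b'
  refine ⟨fun n => (√(T n))⁻¹, fun n => by have := hT n; positivity, ?_, ?_⟩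
  · refine Filter.Tendsto.inv_tendsto_nhdsGT_zero ?_
    rw [tendsto_nhdsWithin_iff]
    refine ⟨?_, Filter.Eventually.of_forall fun n => Real.sqrt_pos.2 (hT n)⟩
    simpa [Function.comp_def] using (Real.continuous_sqrt.tendsto 0).comp hT0
  · have key : ∀ n, b n * (√(T n))⁻¹ ≤ 2 * (√(T n) - √(T (n + 1))) := by
      intro n
      have p1 := Real.sqrt_pos.2 (hT n)
      have p2 := Real.sqrt_pos.2 (hT (n + 1))
      have q1 := Real.sq_sqrt (hT n).le
      have q2 := Real.sq_sqrt (hT (n + 1)).le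
      have hle : b n ≤ T n - T (n + 1) := by
        rw [hTs n]; simp only [b']; have : (0 : ℝ) < (1 / 2) ^ n := by positivity
        linarith
      rw [← div_eq_mul_inv, div_le_iff₀ p1]
      nlinarith [sq_nonneg (√(T n) - √(T (n + 1)))]
    refine summable_of_sum_range_le (c := 2 * √(T 0))
      (fun n => mul_nonneg (hb n) (inv_nonneg.2 (Real.sqrt_nonneg _))) fun n => ?_
    calc _ ≤ ∑ i ∈ Finset.range n, 2 * (√(T i) - √(T (i + 1))) :=
          Finset.sum_le_sum fun i _ => key i
      _ = 2 * (√(T 0) - √(T n)) := by rw [← Finset.mul_sum, Finset.sum_range_sub']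
      _ ≤ _ := by linarith [Real.sqrt_nonneg (T n)]

lemma aux_hasSum (z : L1) : HasSum (fun ν => ‖z ν‖) ‖z‖ := by
  simpa using lp.hasSum_norm (p := 1) (by simp) z

lemma aux_local (R : ℝ≥0∞) (a : (ℕ →₀ ℕ) → ℂ)
    (ha : ∀ σ : ℕ → ℝ, (∀ ν, 0 ≤ σ ν) → (∀ ν, ENNReal.ofReal (σ ν) < R) →
      Filter.Tendsto σ Filter.atTop (nhds 0) →
      ∀ ε > (0 : ℝ),
        {k : ℕ →₀ ℕ | ε ≤ ‖a k‖ * (∏ ν ∈ k.support, σ ν ^ k ν) * kk k / nn k}.Finite)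
    (z₀ : L1) (hz₀ : (‖z₀‖₊ : ℝ≥0∞) < R) :
    ∃ δ > 0, ∃ M : ℝ, ∀ z : L1, ‖z - z₀‖ < δ → ∀ F : Finset (ℕ →₀ ℕ),
      ∑ k ∈ F, ‖a k * monom k (fun ν => z ν)‖ ≤ M := by
  classical
  obtain ⟨r', h1, h2⟩ := ENNReal.lt_iff_exists_nnreal_btwn.1 hz₀
  obtain ⟨r, h3, h4⟩ := ENNReal.lt_iff_exists_nnreal_btwn.1 h1
  have h3' : ‖z₀‖ < r := by exact_mod_cast h3
  have h4' : (r : ℝ) < r' := by exact_mod_cast h4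
  have hr : (0 : ℝ) < r := (norm_nonneg _).trans_lt h3'
  have hs0 := aux_hasSum z₀
  obtain ⟨c, hc0, hct, hcs⟩ := aux_c (fun ν => ‖z₀ ν‖) (fun _ => norm_nonneg _) hs0.summable
  set A := ∑' ν, ‖z₀ ν‖ * c ν with hA
  have hA0 : 0 ≤ A := tsum_nonneg fun ν => mul_nonneg (norm_nonneg _) (hc0 ν).le
  have hlt : ‖z₀‖ / r < 1 := (div_lt_one hr).2 h3'
  obtain ⟨η0, hη0, hη0'⟩ : ∃ η0 > 0, ‖z₀‖ / r + η0 * A < 1 := by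
    refine ⟨(1 - ‖z₀‖ / r) / (A + 1), div_pos (by linarith) (by linarith), ?_⟩
    have : (1 - ‖z₀‖ / r) / (A + 1) * A < (1 - ‖z₀‖ / r) := by
      rw [div_mul_eq_mul_div, div_lt_iff₀ (by linarith)]
      nlinarith
    linarith
  let σ : ℕ → ℝ := fun ν => (1 / r + η0 * c ν)⁻¹
  have hσ0 : ∀ ν, 0 < σ ν := fun ν => by have := hc0 ν; simp only [σ]; positivity
  have hσr : ∀ ν, σ ν ≤ r := fun ν => by
    have := hc0 ν
    simp only [σ]
    rw [inv_le_comm₀ (by positivity) hr]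
    have : 0 ≤ η0 * c ν := by positivity
    rw [one_div]; linarith
  have hσt : Filter.Tendsto σ Filter.atTop (nhds 0) :=
    (Filter.tendsto_atTop_add_const_left _ _ (hct.const_mul_atTop hη0)).inv_tendsto_atTop
  obtain ⟨ε, hε, C, hC⟩ := aux_eps R a ha σ r (r' - r) (by linarith)
    (by simpa using h2) (fun ν => (hσ0 ν).le) hσr hσt
  let β : ℕ → ℝ := fun ν => ‖z₀ ν‖ / σ ν
  have hβ0 : ∀ ν, 0 ≤ β ν := fun ν => div_nonneg (norm_nonneg _) (hσ0 ν).le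
  set s := ‖z₀‖ / r + η0 * A with hs
  have hs0' : 0 ≤ s := by positivity
  have hβs : HasSum β s := by
    have := (hs0.div_const (r : ℝ)).add (hcs.hasSum.mul_left η0)
    refine this.congr_fun ?_ |> fun h => h
    intro ν
    simp only [β, σ, div_inv_eq_mul]
    ring
  set η := (1 - s) / 2 with hη
  have hηp : 0 < η := by linarith
  have hη1 : η ≤ 1 := by linarith
  set D : ℝ := 2 * Real.exp 1 with hD
  have hDp : 2 ≤ D := by linarith [Real.add_one_le_exp 1]
  have hgap : 0 < 1 - (1 + η) * s := by nlinarith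
  obtain ⟨S0, hS0⟩ := summable_iff_vanishing_norm.1 hβs.summable
    ((1 - (1 + η) * s) / (2 * D)) (by positivity)
  obtain ⟨N, hN⟩ := S0.exists_nat_subset_range
  set q0 := (1 + η) * s + (1 - (1 + η) * s) / 2 with hq0
  have hq01 : q0 < 1 := by linarith
  have hdD : ∀ ν, dfac η N ν ≤ D := by intro ν; unfold dfac; split_ifs <;> linarith
  have hd0 : ∀ ν, 0 ≤ dfac η N ν := by intro ν; unfold dfac; split_ifs <;> linarith
  have hq0S : ∀ S : Finset ℕ, ∑ ν ∈ S, dfac η N ν * β ν ≤ q0 := by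
    intro S
    have t1 : ∑ ν ∈ S, β ν ≤ s := sum_le_hasSum S (fun ν _ => hβ0 ν) hβs
    have t2 : ∑ ν ∈ S with ¬ ν < N, β ν ≤ (1 - (1 + η) * s) / (2 * D) := by
      refine (le_abs_self _).trans (hS0 _ ?_).le
      rw [Finset.disjoint_left]
      intro ν hν hν'
      exact (Finset.mem_filter.1 hν).2 (Finset.mem_range.1 (hN hν'))
    calc ∑ ν ∈ S, dfac η N ν * β ν
        ≤ ∑ ν ∈ S, ((1 + η) * β ν + D * (if ¬ ν < N then β ν else 0)) := by
          refine Finset.sum_le_sum fun ν _ => ?_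
          have := hβ0 ν
          unfold dfac
          split_ifs
          · simp
          · have : 0 ≤ (1 + η) * β ν := by positivity
            linarith
      _ = (1 + η) * ∑ ν ∈ S, β ν + D * ∑ ν ∈ S with ¬ ν < N, β ν := by
          rw [Finset.sum_add_distrib, ← Finset.mul_sum, ← Finset.mul_sum, ← Finset.sum_filter]
      _ ≤ (1 + η) * s + D * ((1 - (1 + η) * s) / (2 * D)) := by gcongr
      _ = q0 := by rw [hq0]; field_simp
  have hq00 : 0 ≤ q0 := by simpa using hq0S ∅
  set q := (1 + q0) / 2 with hq
  refine ⟨ε * (1 - q0) / (2 * D), by have : 0 < 1 - q0 := by linarith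
                                     positivity,
    C * (Real.exp 1 / η) ^ N * (1 - q)⁻¹, fun z hz F => ?_⟩
  have hτ : ∀ ν, 0 < σ ν + ε := fun ν => by linarith [hσ0 ν]
  let w : ℕ → ℝ := fun ν => ‖z ν‖ / (σ ν + ε)
  have hw0 : ∀ ν, 0 ≤ w ν := fun ν => div_nonneg (norm_nonneg _) (hτ ν).le
  have hwle : ∀ ν, w ν ≤ β ν + ‖(z - z₀) ν‖ / ε := by
    intro ν
    have e : ‖z ν‖ ≤ ‖z₀ ν‖ + ‖(z - z₀) ν‖ := by
      have : z ν = z₀ ν + (z - z₀) ν := by simp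
      rw [this]; exact norm_add_le _ _
    calc w ν ≤ (‖z₀ ν‖ + ‖(z - z₀) ν‖) / (σ ν + ε) := by
          have := hτ ν
          simp only [w]; gcongr
      _ = ‖z₀ ν‖ / (σ ν + ε) + ‖(z - z₀) ν‖ / (σ ν + ε) := add_div _ _ _
      _ ≤ _ := by
          have := hσ0 ν
          simp only [β]
          gcongr <;> linarith
  have hmul := aux_multi (fun ν => dfac η N ν * w ν) (fun ν => mul_nonneg (hd0 ν) (hw0 ν)) q
    (by linarith) (by linarith) (by
      intro S
      have t1 : ∑ ν ∈ S, ‖(z - z₀) ν‖ ≤ ‖z - z₀‖ :=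
        sum_le_hasSum S (fun ν _ => norm_nonneg _) (aux_hasSum (z - z₀))
      calc ∑ ν ∈ S, dfac η N ν * w ν
          ≤ ∑ ν ∈ S, (dfac η N ν * β ν + D / ε * ‖(z - z₀) ν‖) := by
            refine Finset.sum_le_sum fun ν _ => ?_
            calc dfac η N ν * w ν ≤ dfac η N ν * (β ν + ‖(z - z₀) ν‖ / ε) :=
                  mul_le_mul_of_nonneg_left (hwle ν) (hd0 ν)
              _ = dfac η N ν * β ν + dfac η N ν * (‖(z - z₀) ν‖ / ε) := mul_add _ _ _
              _ ≤ dfac η N ν * β ν + D * (‖(z - z₀) ν‖ / ε) := by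
                  have := hdD ν
                  gcongr
              _ = _ := by ring
        _ = ∑ ν ∈ S, dfac η N ν * β ν + D / ε * ∑ ν ∈ S, ‖(z - z₀) ν‖ := by
            rw [Finset.sum_add_distrib, ← Finset.mul_sum]
        _ ≤ q0 + D / ε * (ε * (1 - q0) / (2 * D)) := by
            have := hq0S S
            have := t1.trans hz.le
            gcongr
        _ = q := by rw [hq]; field_simp; ring) F
  have hnn : ∀ k, 0 < nn k := by
    intro k
    unfold nn
    rcases Nat.eq_zero_or_pos (knormN k) with h | h
    · simp [h]
    · positivity
  have hkk : ∀ k, 0 < kk k := fun k => Finset.prod_pos fun ν hν => by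
    have := Finsupp.mem_support_iff.1 hν
    positivity
  have hτp : ∀ k : ℕ →₀ ℕ, 0 ≤ ∏ ν ∈ k.support, (σ ν + ε) ^ k ν := fun k =>
    Finset.prod_nonneg fun ν _ => pow_nonneg (hτ ν).le _
  have hC0 : 0 ≤ C := by
    refine le_trans ?_ (hC 0)
    have := hnn 0
    have := hkk 0
    have := hτp 0
    positivity
  have hterm : ∀ k, ‖a k * monom k (fun ν => z ν)‖ ≤ C * (Real.exp 1 / η) ^ N *
      ((Nat.multinomial k.support k : ℝ) * ∏ ν ∈ k.support, (dfac η N ν * w ν) ^ k ν) := by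
    intro k
    have e1 : ‖a k * monom k (fun ν => z ν)‖ =
        ‖a k‖ * (∏ ν ∈ k.support, (σ ν + ε) ^ k ν) * ∏ ν ∈ k.support, w ν ^ k ν := by
      rw [norm_mul, monom, norm_prod, mul_assoc, ← Finset.prod_mul_distrib]
      congr 1
      refine Finset.prod_congr rfl fun ν _ => ?_
      rw [norm_pow, ← mul_pow]
      congr 1
      simp only [w]
      rw [mul_div_cancel₀ _ (hτ ν).ne']
    have e2 : ‖a k‖ * (∏ ν ∈ k.support, (σ ν + ε) ^ k ν) ≤ C * ((Real.exp 1 / η) ^ N *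
        (Nat.multinomial k.support k : ℝ) * (∏ ν ∈ k.support, dfac η N ν ^ k ν)) := by
      have h5 := hC k
      rw [div_le_iff₀ (hnn k)] at h5
      have h6 := aux_coef η hηp hη1 N k
      have h7 := h5.trans (mul_le_mul_of_nonneg_left h6 hC0)
      rw [← mul_assoc] at h7
      exact le_of_mul_le_mul_right h7 (hkk k)
    rw [e1]
    refine (mul_le_mul_of_nonneg_right e2
      (Finset.prod_nonneg fun ν _ => pow_nonneg (hw0 ν) _)).trans (le_of_eq ?_)
    simp only [mul_pow, Finset.prod_mul_distrib]
    ring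
  calc _ ≤ ∑ k ∈ F, C * (Real.exp 1 / η) ^ N *
      ((Nat.multinomial k.support k : ℝ) * ∏ ν ∈ k.support, (dfac η N ν * w ν) ^ k ν) :=
        Finset.sum_le_sum fun k _ => hterm k
    _ ≤ _ := by
        rw [← Finset.mul_sum]
        gcongr

/-- Let `0 < R ≤ ∞` and let `(a_k)` be such that for every real sequence `σ`
with `0 ≤ σ_ν < R`, `σ_ν → 0`, the quantities `|a_k| σ^k k^k/‖k‖^{‖k‖}` tend to `0` along the
cofinite filter. Then there is a holomorphic function `h` on `B(R) ⊆ l¹` whose monomial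
coefficients are `(a_k)`; in particular for every `z ∈ B(R)` the family `(a_k z^k)` is
absolutely summable with sum `h(z)`. -/
theorem statement9 (R : ℝ≥0∞) (hR : 0 < R) (a : (ℕ →₀ ℕ) → ℂ)
    (ha : ∀ σ : ℕ → ℝ, (∀ ν, 0 ≤ σ ν) → (∀ ν, ENNReal.ofReal (σ ν) < R) →
      Filter.Tendsto σ Filter.atTop (nhds 0) →
      ∀ ε > (0 : ℝ),
        {k : ℕ →₀ ℕ | ε ≤ ‖a k‖ * (∏ ν ∈ k.support, σ ν ^ k ν) * kk k / nn k}.Finite) :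
    ∃ h : L1 → ℂ,
      DifferentiableOn ℂ h {z : L1 | (‖z‖₊ : ℝ≥0∞) < R} ∧
      ∀ z : L1, (‖z‖₊ : ℝ≥0∞) < R →
        Summable (fun k => ‖a k * monom k (fun ν => z ν)‖) ∧
        HasSum (fun k => a k * monom k (fun ν => z ν)) (h z) := by

  have hsumm : ∀ z : L1, (‖z‖₊ : ℝ≥0∞) < R →
      Summable (fun k => ‖a k * monom k (fun ν => z ν)‖) := by
    intro z hz
    obtain ⟨δ, hδ, M, hM⟩ := aux_local R a ha z hz
    exact summable_of_sum_le (fun _ => norm_nonneg _) (hM z (by simpa using hδ))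
  refine ⟨fun z => ∑' k, a k * monom k (fun ν => z ν), ?_,
    fun z hz => ⟨hsumm z hz, (hsumm z hz).of_norm.hasSum⟩⟩
  intro c hc
  refine DifferentiableAt.differentiableWithinAt ?_
  obtain ⟨δ, hδ, M, hM⟩ := aux_local R a ha c hc
  have hbd : ∀ z ∈ Metric.ball c δ, ∀ F : Finset (ℕ →₀ ℕ),
      ∑ k ∈ F, ‖a k * monom k (fun ν => z ν)‖ ≤ M := fun z hz =>
    hM z (mem_ball_iff_norm.1 hz)
  refine aux_diff (l := Filter.atTop)
    (fun (F : Finset (ℕ →₀ ℕ)) (z : L1) => ∑ k ∈ F, a k * monom k (fun ν => z ν)) ?_ c δ M hδ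
    (fun F z hz => (norm_sum_le _ _).trans (hbd z hz F)) _
    (fun z hz => (summable_of_sum_le (fun _ => norm_nonneg _) (hbd z hz)).of_norm.hasSum)
  intro F
  refine Differentiable.fun_sum fun k _ => Differentiable.const_mul ?_ _
  unfold monom
  have hev : ∀ ν : ℕ, Differentiable ℂ (fun z : L1 => z ν) := fun ν =>
    (lp.evalCLM (𝕜 := ℂ) (fun _ : ℕ => ℂ) 1 ν).differentiable
  intro z
  have hz : ∀ ν ∈ k.support, DifferentiableAt ℂ (fun z : L1 => z ν ^ k ν) z :=
    fun ν _ => ((hev ν) z).fun_pow _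
  exact (HasFDerivAt.finset_prod fun ν hν => (hz ν hν).hasFDerivAt).differentiableAt
end
end
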